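/- arXiv:1005.4583 — 2 statements merged into one kernel-verified Lean document; each statement's English description precedes it below -/
import Mathlib

section
/- For all integers n ≥ 1 and 0 ≤ k ≤ ⌊(n−1)/2⌋, the polynomial (p+q)^k divides a_{n,k}(p,q) in the polynomial ring ℤ[p,q]. -/
open scoped Classical
open Finset

noncomputable section

namespace SZpaper

/-- `σ` as a 1-indexed function on `[1,n]`, extended by `0` elsewhere
(boundary convention `σ(0)=σ(n+1)=0`). -/
def pext (n : ℕ) (σ : Equiv.Perm (Fin n)) (i : ℕ) : ℕ :=
  if h : 1 ≤ i ∧ i ≤ n then ((σ ⟨i - 1, by omega⟩ : Fin n) : ℕ) + 1 else 0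

/-- `σ` extended with the Brändén boundary convention `σ(0)=σ(n+1)=n+1`. -/
def pextB (n : ℕ) (σ : Equiv.Perm (Fin n)) (i : ℕ) : ℕ :=
  if h : 1 ≤ i ∧ i ≤ n then ((σ ⟨i - 1, by omega⟩ : Fin n) : ℕ) + 1 else n + 1

/-- `σ` extended with the boundary convention `σ(0)=0`, `σ(n+1)=n+1`. -/
def pextC (n : ℕ) (σ : Equiv.Perm (Fin n)) (i : ℕ) : ℕ :=
  if h : 1 ≤ i ∧ i ≤ n then ((σ ⟨i - 1, by omega⟩ : Fin n) : ℕ) + 1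
  else if i = 0 then 0 else n + 1

/-- The set of pairs `(i,j)` with `i, j ∈ [1,n]`. -/
def pairs (n : ℕ) : Finset (ℕ × ℕ) := Finset.Icc 1 n ×ˢ Finset.Icc 1 n

/-- `des σ = #{i ∈ [n−1] : σ(i) > σ(i+1)}`. -/
def desStat (n : ℕ) (σ : Equiv.Perm (Fin n)) : ℕ :=
  ((Finset.Icc 1 (n - 1)).filter fun i => pext n σ (i + 1) < pext n σ i).card

/-- `les σ = #{(i,j) : 2 ≤ i < j ≤ n, σ(i−1) > σ(j) > σ(i)}`. -/
def lesStat (n : ℕ) (σ : Equiv.Perm (Fin n)) : ℕ :=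
  ((pairs n).filter fun x => 2 ≤ x.1 ∧ x.1 < x.2 ∧
    pext n σ x.1 < pext n σ x.2 ∧ pext n σ x.2 < pext n σ (x.1 - 1)).card

/-- `less σ = #{(i,j) : 2 ≤ i < j ≤ n, σ(i−1) < σ(j) < σ(i)}`. -/
def lessStat (n : ℕ) (σ : Equiv.Perm (Fin n)) : ℕ :=
  ((pairs n).filter fun x => 2 ≤ x.1 ∧ x.1 < x.2 ∧
    pext n σ (x.1 - 1) < pext n σ x.2 ∧ pext n σ x.2 < pext n σ x.1).card

/-- `res σ = #{(i,j) : 1 ≤ i < j ≤ n−1, σ(j+1) > σ(i) > σ(j)}`. -/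
def resStat (n : ℕ) (σ : Equiv.Perm (Fin n)) : ℕ :=
  ((pairs n).filter fun x => x.1 < x.2 ∧ x.2 ≤ n - 1 ∧
    pext n σ x.2 < pext n σ x.1 ∧ pext n σ x.1 < pext n σ (x.2 + 1)).card

/-- `ress σ = #{(i,j) : 1 ≤ i < j ≤ n−1, σ(j+1) < σ(i) < σ(j)}`. -/
def ressStat (n : ℕ) (σ : Equiv.Perm (Fin n)) : ℕ :=
  ((pairs n).filter fun x => x.1 < x.2 ∧ x.2 ≤ n - 1 ∧
    pext n σ (x.2 + 1) < pext n σ x.1 ∧ pext n σ x.1 < pext n σ x.2).card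

/-! Linear statistics with the boundary convention `σ(0)=σ(n+1)=0` (starred). -/

def peakStar (n : ℕ) (σ : Equiv.Perm (Fin n)) : ℕ :=
  ((Finset.Icc 1 n).filter fun i =>
    pext n σ (i - 1) < pext n σ i ∧ pext n σ (i + 1) < pext n σ i).card

def valleyStar (n : ℕ) (σ : Equiv.Perm (Fin n)) : ℕ :=
  ((Finset.Icc 1 n).filter fun i =>
    pext n σ i < pext n σ (i - 1) ∧ pext n σ i < pext n σ (i + 1)).card

def daStar (n : ℕ) (σ : Equiv.Perm (Fin n)) : ℕ :=
  ((Finset.Icc 1 n).filter fun i =>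
    pext n σ (i - 1) < pext n σ i ∧ pext n σ i < pext n σ (i + 1)).card

def ddStar (n : ℕ) (σ : Equiv.Perm (Fin n)) : ℕ :=
  ((Finset.Icc 1 n).filter fun i =>
    pext n σ (i + 1) < pext n σ i ∧ pext n σ i < pext n σ (i - 1)).card

/-! Linear statistics with the Brändén boundary convention `σ(0)=σ(n+1)=n+1`. -/

def peakB (n : ℕ) (σ : Equiv.Perm (Fin n)) : ℕ :=
  ((Finset.Icc 1 n).filter fun i =>
    pextB n σ (i - 1) < pextB n σ i ∧ pextB n σ (i + 1) < pextB n σ i).card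

def valleyB (n : ℕ) (σ : Equiv.Perm (Fin n)) : ℕ :=
  ((Finset.Icc 1 n).filter fun i =>
    pextB n σ i < pextB n σ (i - 1) ∧ pextB n σ i < pextB n σ (i + 1)).card

def daB (n : ℕ) (σ : Equiv.Perm (Fin n)) : ℕ :=
  ((Finset.Icc 1 n).filter fun i =>
    pextB n σ (i - 1) < pextB n σ i ∧ pextB n σ i < pextB n σ (i + 1)).card

def ddB (n : ℕ) (σ : Equiv.Perm (Fin n)) : ℕ :=
  ((Finset.Icc 1 n).filter fun i =>
    pextB n σ (i + 1) < pextB n σ i ∧ pextB n σ i < pextB n σ (i - 1)).card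

/-! Linear statistics with the boundary convention `σ(0)=0`, `σ(n+1)=n+1`. -/

def valleyC (n : ℕ) (σ : Equiv.Perm (Fin n)) : ℕ :=
  ((Finset.Icc 1 n).filter fun i =>
    pextC n σ i < pextC n σ (i - 1) ∧ pextC n σ i < pextC n σ (i + 1)).card

def daC (n : ℕ) (σ : Equiv.Perm (Fin n)) : ℕ :=
  ((Finset.Icc 1 n).filter fun i =>
    pextC n σ (i - 1) < pextC n σ i ∧ pextC n σ i < pextC n σ (i + 1)).card

def ddC (n : ℕ) (σ : Equiv.Perm (Fin n)) : ℕ :=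
  ((Finset.Icc 1 n).filter fun i =>
    pextC n σ (i + 1) < pextC n σ i ∧ pextC n σ i < pextC n σ (i - 1)).card

/-- `fmax σ`: the number of double ascents (convention `σ(0)=0`, `σ(n+1)=n+1`)
which are left-to-right maxima. -/
def fmaxStat (n : ℕ) (σ : Equiv.Perm (Fin n)) : ℕ :=
  ((Finset.Icc 1 n).filter fun i =>
    pextC n σ (i - 1) < pextC n σ i ∧ pextC n σ i < pextC n σ (i + 1) ∧
    ∀ j ∈ Finset.Ico 1 i, pext n σ j < pext n σ i).card

/-! Cyclic statistics. -/

def excStat (n : ℕ) (σ : Equiv.Perm (Fin n)) : ℕ :=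
  ((Finset.Icc 1 n).filter fun i => i < pext n σ i).card

def wexStat (n : ℕ) (σ : Equiv.Perm (Fin n)) : ℕ :=
  ((Finset.Icc 1 n).filter fun i => i ≤ pext n σ i).card

def dropStat (n : ℕ) (σ : Equiv.Perm (Fin n)) : ℕ :=
  ((Finset.Icc 1 n).filter fun i => pext n σ i < i).card

def fixStat (n : ℕ) (σ : Equiv.Perm (Fin n)) : ℕ :=
  ((Finset.Icc 1 n).filter fun i => pext n σ i = i).card

/-- cyclic valleys: `x` with `σ⁻¹(x) > x < σ(x)`. -/
def cvalleyStat (n : ℕ) (σ : Equiv.Perm (Fin n)) : ℕ :=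
  ((Finset.Icc 1 n).filter fun x => x < pext n σ⁻¹ x ∧ x < pext n σ x).card

/-- double excedances: `x` with `σ⁻¹(x) < x < σ(x)`. -/
def cdaStat (n : ℕ) (σ : Equiv.Perm (Fin n)) : ℕ :=
  ((Finset.Icc 1 n).filter fun x => pext n σ⁻¹ x < x ∧ x < pext n σ x).card

/-- double drops: `x` with `σ⁻¹(x) > x > σ(x)`. -/
def cddStat (n : ℕ) (σ : Equiv.Perm (Fin n)) : ℕ :=
  ((Finset.Icc 1 n).filter fun x => x < pext n σ⁻¹ x ∧ pext n σ x < x).card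

/-- crossings. -/
def crosStat (n : ℕ) (σ : Equiv.Perm (Fin n)) : ℕ :=
  ((pairs n).filter fun x =>
    (x.1 < x.2 ∧ x.2 ≤ pext n σ x.1 ∧ pext n σ x.1 < pext n σ x.2) ∨
    (x.2 < x.1 ∧ pext n σ x.1 < x.2 ∧ pext n σ x.2 < pext n σ x.1)).card

/-- nestings. -/
def nestStat (n : ℕ) (σ : Equiv.Perm (Fin n)) : ℕ :=
  ((pairs n).filter fun x =>
    (x.1 < x.2 ∧ x.2 ≤ pext n σ x.2 ∧ pext n σ x.2 < pext n σ x.1) ∨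
    (x.2 < x.1 ∧ pext n σ x.2 < x.2 ∧ pext n σ x.1 < pext n σ x.2)).card

/-- number of cycles of `σ` (fixed points count as cycles). -/
def cycStat (n : ℕ) (σ : Equiv.Perm (Fin n)) : ℕ :=
  Multiset.card σ.cycleType + (Finset.univ.filter fun x => σ x = x).card

/-! Star statistics: `σ*(i) = σ(i) − 1`, a bijection `[n] → {0,…,n−1}`;
we extend `σ*` by `0` outside `[1,n]`. -/

def starf (n : ℕ) (σ : Equiv.Perm (Fin n)) (i : ℕ) : ℕ :=
  if 1 ≤ i ∧ i ≤ n then pext n σ i - 1 else 0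

/-- `(σ*)⁻¹(i) = σ⁻¹(i+1)`, defined for `0 ≤ i ≤ n−1`. -/
def invstarf (n : ℕ) (σ : Equiv.Perm (Fin n)) (i : ℕ) : ℕ :=
  pext n σ⁻¹ (i + 1)

def dropStarStat (n : ℕ) (σ : Equiv.Perm (Fin n)) : ℕ :=
  ((Finset.Icc 1 n).filter fun i => starf n σ i < i).card

def fixStarStat (n : ℕ) (σ : Equiv.Perm (Fin n)) : ℕ :=
  ((Finset.Icc 1 n).filter fun i => starf n σ i = i).card

def wexStarStat (n : ℕ) (σ : Equiv.Perm (Fin n)) : ℕ :=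
  ((Finset.Icc 1 n).filter fun i => i ≤ starf n σ i).card

def cdaStarStat (n : ℕ) (σ : Equiv.Perm (Fin n)) : ℕ :=
  ((Finset.Icc 1 n).filter fun i => invstarf n σ i < i ∧ i < starf n σ i).card

def cddStarStat (n : ℕ) (σ : Equiv.Perm (Fin n)) : ℕ :=
  ((Finset.Icc 1 n).filter fun i => i < invstarf n σ i ∧ starf n σ i < i).card

def cvalleyStarStat (n : ℕ) (σ : Equiv.Perm (Fin n)) : ℕ :=
  ((Finset.Icc 1 n).filter fun i => i < invstarf n σ i ∧ i < starf n σ i).card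

def crosStarStat (n : ℕ) (σ : Equiv.Perm (Fin n)) : ℕ :=
  ((pairs n).filter fun x =>
    (x.1 < x.2 ∧ x.2 ≤ starf n σ x.1 ∧ starf n σ x.1 < starf n σ x.2) ∨
    (x.2 < x.1 ∧ starf n σ x.1 < x.2 ∧ starf n σ x.2 < starf n σ x.1)).card

def nestStarStat (n : ℕ) (σ : Equiv.Perm (Fin n)) : ℕ :=
  ((pairs n).filter fun x =>
    (x.1 < x.2 ∧ x.2 ≤ starf n σ x.2 ∧ starf n σ x.2 < starf n σ x.1) ∨
    (x.2 < x.1 ∧ starf n σ x.2 < x.2 ∧ starf n σ x.1 < starf n σ x.2)).card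

/-- `cyc* σ`: the number of cycles of the functional digraph of `σ*` on `[n]`,
counted as the number of `i ∈ [1,n]` that lie on a cycle of `σ*` and are
minimal in their cycle. (The component of `σ*` that is a path from `n` to `0`
contributes no such `i`.) -/
def cycStarStat (n : ℕ) (σ : Equiv.Perm (Fin n)) : ℕ :=
  ((Finset.Icc 1 n).filter fun i =>
    (∃ m ∈ Finset.Icc 1 n, (starf n σ)^[m] i = i) ∧
    ∀ m ∈ Finset.range (n + 1), i ≤ (starf n σ)^[m] i).card

/-! Motzkin paths, encoded as step sequences `γ : Fin m → Fin 3`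
(`0` = up step `(1,1)`, `1` = level step `(1,0)`, `2` = down step `(1,−1)`). -/

/-- The height (ordinate) of the path after `i` steps. -/
def hgt (m : ℕ) (γ : Fin m → Fin 3) (i : ℕ) : ℤ :=
  ∑ j ∈ Finset.range i, if hj : j < m then 1 - ((γ ⟨j, hj⟩ : ℕ) : ℤ) else 0

/-- A step sequence is a Motzkin path if it never goes below the x-axis and
ends at height `0`. -/
def IsMotzkin (m : ℕ) (γ : Fin m → Fin 3) : Prop :=
  (∀ i ≤ m, 0 ≤ hgt m γ i) ∧ hgt m γ m = 0

/-- The (finite) set of Motzkin paths of length `m`. -/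
def motzkin (m : ℕ) : Finset (Fin m → Fin 3) :=
  Finset.univ.filter fun γ => IsMotzkin m γ

/-- number of up (North-East) steps. -/
def neCount (m : ℕ) (γ : Fin m → Fin 3) : ℕ :=
  (Finset.univ.filter fun i => γ i = 0).card

/-- number of level (East) steps. -/
def eCount (m : ℕ) (γ : Fin m → Fin 3) : ℕ :=
  (Finset.univ.filter fun i => γ i = 1).card

/-- the `(p,q)`-integer `[m]_{p,q} = p^{m−1} + p^{m−2}q + ⋯ + q^{m−1}`. -/
def pqInt {R : Type*} [CommRing R] (p q : R) (m : ℕ) : R :=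
  ∑ j ∈ Finset.range m, p ^ (m - 1 - j) * q ^ j

open MvPolynomial in
/-- `a_{n,k}(p,q) ∈ ℤ[p,q]` (with `p = X 0`, `q = X 1`). -/
def aPoly (n k : ℕ) : MvPolynomial (Fin 2) ℤ :=
  ∑ σ ∈ Finset.univ.filter
      (fun σ : Equiv.Perm (Fin n) => valleyStar n σ = k ∧ ddStar n σ = 0),
    X 0 ^ resStat n σ * X 1 ^ lesStat n σ

/-- The number of entries of a word lying strictly between `b` and `a`. -/
def between (b a : ℕ) (t : List ℕ) : ℕ := t.countP fun x => b < x ∧ x < a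

@[simp] lemma between_nil (b a : ℕ) : between b a [] = 0 := rfl

@[simp] lemma between_cons (b a x : ℕ) (t : List ℕ) :
    between b a (x :: t) = between b a t + if b < x ∧ x < a then 1 else 0 := by
  simp only [between, List.countP_cons, decide_eq_true_eq]

lemma between_append (b a : ℕ) (s t : List ℕ) :
    between b a (s ++ t) = between b a s + between b a t := List.countP_append

/-- `les` of a word. -/
def lesL : List ℕ → ℕ
  | a :: b :: t => between b a t + lesL (b :: t)
  | _ => 0

/-- The number of consecutive triples of a word satisfying `R`. -/
def tri (R : ℕ → ℕ → ℕ → Prop) : List ℕ → ℕ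
  | a :: b :: c :: t => (if R a b c then 1 else 0) + tri R (b :: c :: t)
  | _ => 0

/-- `b` is a valley between `a` and `c`. -/
def IsVal (a b c : ℕ) : Prop := b < a ∧ b < c

/-- `b` is a double descent between `a` and `c`. -/
def IsDD (a b c : ℕ) : Prop := c < b ∧ b < a

lemma tri_append (R : ℕ → ℕ → ℕ → Prop) (P : List ℕ) (a b : ℕ) (Q : List ℕ) :
    tri R (P ++ a :: b :: Q) = tri R (P ++ [a, b]) + tri R (a :: b :: Q) := by
  induction P with
  | nil => simp [tri]
  | cons x P ih =>
    cases P with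
    | nil => simp [tri]
    | cons y P =>
      cases P with
      | nil => simp only [List.cons_append, List.nil_append, tri]; omega
      | cons z P => simp only [List.cons_append, tri] at ih ⊢; omega

lemma tri_concat_congr (R : ℕ → ℕ → ℕ → Prop) (P : List ℕ) (a x y : ℕ)
    (h : ∀ z, R z a x ↔ R z a y) : tri R (P ++ [a, x]) = tri R (P ++ [a, y]) := by
  rcases List.eq_nil_or_concat P with rfl | ⟨P, z, rfl⟩
  · simp [tri]
  · simp only [List.concat_eq_append, List.append_assoc, List.cons_append, List.nil_append]
    rw [tri_append R P z a [x], tri_append R P z a [y]]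
    simp [tri, h]

lemma tri_cons_congr (R : ℕ → ℕ → ℕ → Prop) (Q : List ℕ) (b x y : ℕ)
    (h : ∀ z, R x b z ↔ R y b z) : tri R (x :: b :: Q) = tri R (y :: b :: Q) := by
  cases Q <;> simp [tri, h]

section Insert

variable {N u : ℕ}

lemma tri_peak (R : ℕ → ℕ → ℕ → Prop) (P Q : List ℕ) (a b : ℕ)
    (h1 : ∀ z, R z a u ↔ R z a N) (h2 : ∀ z, R u b z ↔ R N b z) (h3 : R a u b ↔ R a N b) :
    tri R (P ++ a :: u :: b :: Q) = tri R (P ++ a :: N :: b :: Q) := by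
  rw [tri_append, tri_append R P a N, tri_concat_congr R P a u N h1]
  simp only [tri, h3]
  rw [tri_cons_congr R Q b u N h2]

lemma tri_asc (R : ℕ → ℕ → ℕ → Prop) (P Q : List ℕ) (a b : ℕ)
    (h1 : ∀ z, R z a u ↔ R z a N) (h2 : R u N b ↔ R a N b) (h3 : ¬ R a u N) :
    tri R (P ++ a :: u :: N :: b :: Q) = tri R (P ++ a :: N :: b :: Q) := by
  rw [tri_append, tri_append R P a N, tri_concat_congr R P a u N h1]
  simp [tri, h3, h2]

lemma tri_valley (R : ℕ → ℕ → ℕ → Prop) (P Q : List ℕ) (a b : ℕ)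
    (h2 : R u N b ↔ R a N b) (h3 : ¬ R a N u) :
    tri R (P ++ a :: N :: u :: N :: b :: Q)
      = tri R (P ++ a :: N :: b :: Q) + if R N u N then 1 else 0 := by
  rw [tri_append, tri_append R P a N (b :: Q)]
  simp only [tri, h3, h2, if_false]
  omega

lemma lesL_insert (hu : u < N) (X : List ℕ)
    (hX : X = [u] ∨ X = [u, N] ∨ X = [N, u] ∨ X = [N, u, N]) (A B : List ℕ)
    (hA : ∀ x ∈ A, x < u ∨ x = N) (hB : ∀ x ∈ B, x < u ∨ x = N)
    (hc : (A ++ [N]).IsChain fun a b => ¬ (a = N ∧ b = N)) :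
    lesL (A ++ (X ++ B)) = lesL (A ++ N :: B) + A.count N := by
  have hno : ∀ b, between b u B = between b N B := by
    intro b
    apply List.countP_congr
    intro x hx
    have := hB x hx
    simp only [decide_eq_true_eq]
    omega
  have hz : ∀ b c, u ≤ b → c ≤ N → between b c B = 0 := by
    intro b c hb hc
    rw [between, List.countP_eq_zero]
    intro x hx
    have := hB x hx
    simp only [decide_eq_true_eq]
    omega
  have h0 : lesL (u :: B) = lesL (N :: B) := by
    cases B with
    | nil => simp [lesL]
    | cons b B =>
      have := hno b
      simp only [between_cons, lt_irrefl, false_and, if_false] at this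
      simp only [lesL]
      omega
  have hNu : ¬ N < u := by omega
  have hb : lesL (X ++ B) = lesL (N :: B) := by
    rcases hX with rfl | rfl | rfl | rfl
    · exact h0
    · simp [lesL, hz N u hu.le hu.le]
    · simp [lesL, hz u N le_rfl le_rfl, h0]
    · simp [lesL, hz u N le_rfl le_rfl, hz N u hu.le hu.le]
  induction A with
  | nil => simpa using hb
  | cons a A ih =>
    have ha := hA a (by simp)
    have ih := ih (fun x hx => hA x (by simp [hx])) (by
      simp only [List.cons_append] at hc
      exact hc.tail)
    cases A with
    | nil =>
      have haN : a ≠ N := by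
        intro h
        simp [h] at hc
      have hau : a < u := by omega
      have e1 : between N a B = 0 := hz N a hu.le (by omega)
      have e2 : between u a B = 0 := hz u a le_rfl (by omega)
      have e3 : ¬ u < a := by omega
      have e4 : ¬ N < a := by omega
      simp only [List.nil_append, List.count_nil, add_zero] at ih
      rcases hX with rfl | rfl | rfl | rfl <;>
        simp only [List.cons_append, List.nil_append] at ih ⊢ <;>
        rw [lesL, ih] <;> simp [lesL, e1, e2, e3, e4, haN]
    | cons b A =>
      have hb' := hA b (by simp)
      have hab : ¬ (a = N ∧ b = N) := by
        simp only [List.cons_append, List.isChain_cons_cons] at hc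
        exact hc.1
      have e : between b a (A ++ (X ++ B))
          = between b a (A ++ N :: B) + if a = N then 1 else 0 := by
        rcases hX with rfl | rfl | rfl | rfl <;>
          simp only [between_append, between_cons, between_nil] <;>
          split_ifs <;> omega
      simp only [List.cons_append, lesL] at ih ⊢
      rw [e, ih, List.count_cons (a := N) (b := a)]
      simp only [beq_iff_eq]
      omega

end Insert

/-- The bracket `[m]_{p,q}`. -/
def br {R : Type*} [CommRing R] (p q : R) : ℕ → R
  | 0 => 0
  | m + 1 => p ^ m + q * br p q m

lemma dvd_br_even {R : Type*} [CommRing R] (p q : R) (j : ℕ) : p + q ∣ br p q (2 * j) := by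
  induction j with
  | zero => simp [br]
  | succ j ih =>
    have : br p q (2 * (j + 1)) = (p + q) * p ^ (2 * j) + q ^ 2 * br p q (2 * j) := by
      rw [show 2 * (j + 1) = 2 * j + 1 + 1 by ring]
      simp only [br]
      ring
    rw [this]
    exact dvd_add (dvd_mul_right _ _) (ih.mul_left _)

lemma dvd_br_mul_br {R : Type*} [CommRing R] (p q : R) (m : ℕ) :
    p + q ∣ br p q m * br p q (m + 1) := by
  rcases Nat.even_or_odd' m with ⟨j, rfl | rfl⟩
  · exact (dvd_br_even p q j).mul_right _
  · exact (dvd_br_even p q (j + 1)).mul_left _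

/-- All ways of writing a word as `A ++ N :: B`. -/
def splits (N : ℕ) : List ℕ → Finset (List ℕ × List ℕ)
  | [] => ∅
  | a :: t => (if a = N then {([], t)} else ∅) ∪ (splits N t).image fun x => (a :: x.1, x.2)

lemma mem_splits {N : ℕ} {w : List ℕ} {x : List ℕ × List ℕ} :
    x ∈ splits N w ↔ x.1 ++ N :: x.2 = w := by
  induction w generalizing x with
  | nil => simp [splits]
  | cons a t ih =>
    obtain ⟨A, B⟩ := x
    simp only [splits, Finset.mem_union, Finset.mem_image, ih, Prod.exists, Prod.mk.injEq]
    cases A with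
    | nil =>
      split_ifs with h
      · subst h
        simp [eq_comm]
      · simp [Ne.symm h]
    | cons c A =>
      split_ifs <;> simp <;> grind

lemma sum_splits {R : Type*} [CommRing R] (p q : R) (N : ℕ) (w : List ℕ) :
    ∑ x ∈ splits N w, p ^ x.2.count N * q ^ x.1.count N = br p q (w.count N) := by
  induction w with
  | nil => simp [splits, br]
  | cons a t ih =>
    rw [splits, Finset.sum_union, Finset.sum_image]
    · by_cases h : a = N
      · subst h
        simp only [if_true, Finset.sum_singleton, List.count_cons_self, br, ← ih, Finset.mul_sum,
          List.count_nil, pow_zero, mul_one]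
        congr 1
        apply Finset.sum_congr rfl
        intros
        ring
      · simp [h, ih]
    · rintro ⟨A, B⟩ - ⟨A', B'⟩ - hh
      simpa using hh
    · rw [Finset.disjoint_left]
      split_ifs
      · simp
      · simp

/-- The entries `1, …, v` together with `m` copies of `N`. -/
def content (N : ℕ) : ℕ → ℕ → List ℕ
  | 0, m => List.replicate m N
  | v + 1, m => (v + 1) :: content N v m

lemma content_succ_perm (N v m : ℕ) : (content N v (m + 1)).Perm (N :: content N v m) := by
  induction v with
  | zero => simp [content, List.replicate_succ]
  | succ v ih => exact (ih.cons _).trans (List.Perm.swap _ _ _)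

lemma of_mem_content {N v m x : ℕ} (h : x ∈ content N v m) : (1 ≤ x ∧ x ≤ v) ∨ x = N := by
  induction v with
  | zero => exact Or.inr (List.eq_of_mem_replicate h)
  | succ v ih =>
    rcases List.mem_cons.1 h with h | h
    · omega
    · have := ih h
      omega

lemma count_content {N v m : ℕ} (h : v < N) : (content N v m).count N = m := by
  induction v with
  | zero => simp [content]
  | succ v ih => rw [content, List.count_cons_of_ne (by omega), ih (by omega)]

/-- The word with the boundary convention `0` on both sides. -/
def pad (t : List ℕ) : List ℕ := 0 :: (t ++ [0])

/-- The words obtained from the permutations in question by keeping the values `1, …, v` and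
replacing every maximal run of larger values by the single letter `N`. -/
def Good (N v m k : ℕ) (t : List ℕ) : Prop :=
  t.Perm (content N v m) ∧ (t.IsChain fun a b => ¬ (a = N ∧ b = N)) ∧
    tri IsDD (pad t) = 0 ∧ tri IsVal (pad t) = k

section Words

variable {N v m k : ℕ} {A B : List ℕ}

lemma perm_bounds (h : (A ++ N :: B).Perm (content N v m)) :
    (∀ x ∈ A, x < v + 1 ∨ x = N) ∧ ∀ x ∈ B, x < v + 1 ∨ x = N := by
  constructor <;> intro x hx <;>
  · have := of_mem_content (h.mem_iff.1 (show x ∈ A ++ N :: B by simp [hx]))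
    omega

lemma exists_pad_left (hA : ∀ x ∈ A, x < v + 1 ∨ x = N) (hl : ∀ x ∈ A.getLast?, x ≠ N) :
    ∃ P a, 0 :: A = P ++ [a] ∧ a < v + 1 := by
  rcases List.eq_nil_or_concat A with rfl | ⟨A', a, rfl⟩
  · exact ⟨[], 0, rfl, by omega⟩
  · have h1 := hA a (by simp)
    have h2 := hl a (by simp)
    exact ⟨0 :: A', a, by simp, by omega⟩

lemma exists_pad_right (hB : ∀ x ∈ B, x < v + 1 ∨ x = N) (hh : ∀ x ∈ B.head?, x ≠ N) :
    ∃ b Q, B ++ [0] = b :: Q ∧ b < v + 1 := by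
  cases B with
  | nil => exact ⟨0, [], rfl, by omega⟩
  | cons b B =>
    have h1 := hB b (by simp)
    have h2 := hh b (by simp)
    exact ⟨b, B ++ [0], rfl, by omega⟩

lemma pad_insert (X : List ℕ) {P Q : List ℕ} {a b : ℕ} (hP : 0 :: A = P ++ [a])
    (hQ : B ++ [0] = b :: Q) : pad (A ++ (X ++ B)) = P ++ a :: (X ++ b :: Q) := by
  rw [pad, ← hQ, ← List.cons_append, ← List.cons_append, hP]
  simp

lemma isChain_insert (X : List ℕ) (hl : ∀ x ∈ A.getLast?, x ≠ N)
    (hh : ∀ x ∈ B.head?, x ≠ N) :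
    (A ++ (X ++ B)).IsChain (fun a b => ¬ (a = N ∧ b = N)) ↔
      A.IsChain (fun a b => ¬ (a = N ∧ b = N)) ∧ X.IsChain (fun a b => ¬ (a = N ∧ b = N)) ∧
        B.IsChain (fun a b => ¬ (a = N ∧ b = N)) := by
  rw [List.isChain_append, List.isChain_append]
  constructor
  · rintro ⟨h1, ⟨h2, h3, -⟩, -⟩
    exact ⟨h1, h2, h3⟩
  · rintro ⟨h1, h2, h3⟩
    exact ⟨h1, ⟨h2, h3, fun x _ y hy h => hh y hy h.2⟩, fun x hx y _ h => hl x hx h.1⟩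

lemma ends_of_isChain (h : (A ++ N :: B).IsChain fun a b => ¬ (a = N ∧ b = N)) :
    (∀ x ∈ A.getLast?, x ≠ N) ∧ ∀ x ∈ B.head?, x ≠ N := by
  rw [List.isChain_append, List.isChain_cons] at h
  exact ⟨fun x hx e => h.2.2 x hx N (by simp) ⟨e, rfl⟩, fun x hx e => h.2.1.1 x hx ⟨rfl, e⟩⟩

lemma good_peak (hv : v + 1 < N) (hl : ∀ x ∈ A.getLast?, x ≠ N) (hh : ∀ x ∈ B.head?, x ≠ N) :
    Good N (v + 1) m k (A ++ (v + 1) :: B) ↔ Good N v (m + 1) k (A ++ N :: B) := by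
  have hp : (A ++ (v + 1) :: B).Perm (content N (v + 1) m) ↔
      (A ++ N :: B).Perm (content N v (m + 1)) := by
    rw [content, (List.perm_middle).congr_left, List.perm_cons,
      (content_succ_perm N v m).congr_right, (List.perm_middle).congr_left, List.perm_cons]
  unfold Good
  rw [hp]
  apply and_congr_right
  intro h
  obtain ⟨hA, hB⟩ := perm_bounds h
  obtain ⟨P, a, hP, ha⟩ := exists_pad_left hA hl
  obtain ⟨b, Q, hQ, hb⟩ := exists_pad_right hB hh
  have e1 := pad_insert [v + 1] hP hQ
  have e2 := pad_insert [N] hP hQ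
  have c1 := isChain_insert [v + 1] hl hh
  have c2 := isChain_insert [N] hl hh
  simp only [List.cons_append, List.nil_append] at e1 e2 c1 c2
  rw [e1, e2, c1, c2, tri_peak (N := N) IsDD, tri_peak (N := N) IsVal]
  · simp
  all_goals simp only [IsVal, IsDD]
  all_goals intros
  all_goals omega

lemma good_asc (hv : v + 1 < N) (hl : ∀ x ∈ A.getLast?, x ≠ N) (hh : ∀ x ∈ B.head?, x ≠ N) :
    Good N (v + 1) m k (A ++ (v + 1) :: N :: B) ↔ Good N v m k (A ++ N :: B) := by
  have hp : (A ++ (v + 1) :: N :: B).Perm (content N (v + 1) m) ↔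
      (A ++ N :: B).Perm (content N v m) := by
    rw [content, (List.perm_middle).congr_left, List.perm_cons]
  unfold Good
  rw [hp]
  apply and_congr_right
  intro h
  obtain ⟨hA, hB⟩ := perm_bounds h
  obtain ⟨P, a, hP, ha⟩ := exists_pad_left hA hl
  obtain ⟨b, Q, hQ, hb⟩ := exists_pad_right hB hh
  have e1 := pad_insert [v + 1, N] hP hQ
  have e2 := pad_insert [N] hP hQ
  have c1 := isChain_insert [v + 1, N] hl hh
  have c2 := isChain_insert [N] hl hh
  simp only [List.cons_append, List.nil_append] at e1 e2 c1 c2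
  rw [e1, e2, c1, c2, tri_asc (N := N) IsDD, tri_asc (N := N) IsVal]
  · simp [hv.ne]
  all_goals simp only [IsVal, IsDD]
  all_goals intros
  all_goals omega

lemma good_valley (hv : v + 1 < N) (hl : ∀ x ∈ A.getLast?, x ≠ N) (hh : ∀ x ∈ B.head?, x ≠ N) :
    Good N (v + 1) (m + 1) k (A ++ N :: (v + 1) :: N :: B) ↔
      ∃ k', k = k' + 1 ∧ Good N v m k' (A ++ N :: B) := by
  have hp : (A ++ N :: (v + 1) :: N :: B).Perm (content N (v + 1) (m + 1)) ↔
      (A ++ N :: B).Perm (content N v m) := by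
    rw [(content_succ_perm N (v + 1) m).congr_right, (List.perm_middle).congr_left, List.perm_cons,
      content, (List.perm_middle).congr_left, List.perm_cons]
  have key : (A ++ N :: B).Perm (content N v m) →
      (((A ++ N :: (v + 1) :: N :: B).IsChain (fun a b => ¬ (a = N ∧ b = N)) ↔
        (A ++ N :: B).IsChain (fun a b => ¬ (a = N ∧ b = N))) ∧
      tri IsDD (pad (A ++ N :: (v + 1) :: N :: B)) = tri IsDD (pad (A ++ N :: B)) ∧
      tri IsVal (pad (A ++ N :: (v + 1) :: N :: B)) = tri IsVal (pad (A ++ N :: B)) + 1) := by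
    intro h
    obtain ⟨hA, hB⟩ := perm_bounds h
    obtain ⟨P, a, hP, ha⟩ := exists_pad_left hA hl
    obtain ⟨b, Q, hQ, hb⟩ := exists_pad_right hB hh
    have e1 := pad_insert [N, v + 1, N] hP hQ
    have e2 := pad_insert [N] hP hQ
    have c1 := isChain_insert [N, v + 1, N] hl hh
    have c2 := isChain_insert [N] hl hh
    simp only [List.cons_append, List.nil_append] at e1 e2 c1 c2
    rw [e1, e2, c1, c2, tri_valley (N := N) IsDD, tri_valley (N := N) IsVal]
    · refine ⟨by simp [hv.ne], ?_, ?_⟩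
      · rw [if_neg (by simp only [IsDD]; omega)]
        rfl
      · rw [if_pos ⟨hv, hv⟩]
    all_goals simp only [IsVal, IsDD]
    all_goals omega
  unfold Good
  rw [hp]
  constructor
  · rintro ⟨h, h1, h2, h3⟩
    obtain ⟨k1, k2, k3⟩ := key h
    exact ⟨_, h3.symm.trans k3, h, k1.1 h1, k2 ▸ h2, rfl⟩
  · rintro ⟨k', rfl, h, h1, h2, h3⟩
    obtain ⟨k1, k2, k3⟩ := key h
    exact ⟨h, k1.2 h1, k2.trans h2, by rw [k3, h3]⟩

lemma not_good_desc (hv : v + 1 < N) (hh : ∀ x ∈ B.head?, x ≠ N) :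
    ¬ Good N (v + 1) m k (A ++ N :: (v + 1) :: B) := by
  rintro ⟨h, -, h2, -⟩
  have hB : ∀ x ∈ B, x < v + 1 ∨ x = N := by
    have h' : (A ++ [N] ++ (v + 1) :: B).Perm (content N (v + 1) m) := by simpa using h
    rw [content, (List.perm_middle).congr_left, List.perm_cons] at h'
    intro x hx
    have := of_mem_content (h'.mem_iff.1 (List.mem_append_right _ hx))
    omega
  obtain ⟨b, Q, hQ, hb⟩ := exists_pad_right hB hh
  have e : pad (A ++ N :: (v + 1) :: B) = (0 :: A) ++ N :: (v + 1) :: b :: Q := by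
    rw [← hQ]
    simp [pad]
  rw [e, tri_append, tri, if_pos ⟨hb, hv⟩] at h2
  omega

end Words

section Sums

variable {R : Type*} [CommRing R] (p q : R)

/-- The weight `p ^ res * q ^ les` of a word. -/
def wt (t : List ℕ) : R := p ^ lesL t.reverse * q ^ lesL t

lemma wt_insert {N v m k : ℕ} (hv : v + 1 < N) {A B : List ℕ} (h : Good N v m k (A ++ N :: B))
    (X : List ℕ) (hX : X = [v + 1] ∨ X = [v + 1, N] ∨ X = [N, v + 1, N]) :
    wt p q (A ++ (X ++ B)) = p ^ B.count N * q ^ A.count N * wt p q (A ++ N :: B) := by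
  obtain ⟨hp, hc, -, -⟩ := h
  obtain ⟨hA, hB⟩ := perm_bounds hp
  have h1 := lesL_insert hv X (by tauto) A B hA hB
    (List.IsChain.left_of_append (l₂ := B) (by simpa using hc))
  have hc' : (B.reverse ++ [N]).IsChain fun a b => ¬ (a = N ∧ b = N) := by
    rw [← List.reverse_cons, List.isChain_reverse]
    refine (List.IsChain.right_of_append hc).imp ?_
    intro a b h1 h2
    exact h1 h2.symm
  have h2 := lesL_insert hv X.reverse
    (by rcases hX with rfl | rfl | rfl <;> simp) B.reverse A.reverse
    (by simpa using hB) (by simpa using hA) hc'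
  simp only [wt, List.reverse_append, List.reverse_cons, List.append_assoc,
    List.count_reverse, List.cons_append, List.nil_append] at h1 h2 ⊢
  rw [h1, h2]
  ring

/-- The finite set of words satisfying `Good`. -/
def words (N v m k : ℕ) : Finset (List ℕ) :=
  (content N v m).permutations.toFinset.filter (Good N v m k)

lemma mem_words {N v m k : ℕ} {t : List ℕ} : t ∈ words N v m k ↔ Good N v m k t := by
  simp only [words, Finset.mem_filter, List.mem_toFinset, List.mem_permutations]
  exact ⟨fun h => h.2, fun h => ⟨h.1, h⟩⟩

/-- Good words with a marked letter `N`. -/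
def marked (N v m k : ℕ) : Finset (List ℕ × List ℕ) := (words N v m k).biUnion (splits N)

lemma mem_marked {N v m k : ℕ} {x : List ℕ × List ℕ} :
    x ∈ marked N v m k ↔ Good N v m k (x.1 ++ N :: x.2) := by
  simp [marked, mem_words, mem_splits]

/-- The generating polynomial of the good words. -/
def gen (N v m k : ℕ) : R := ∑ t ∈ words N v m k, wt p q t

lemma sum_marked {N v m k : ℕ} (hv : v < N) :
    ∑ x ∈ marked N v m k, p ^ x.2.count N * q ^ x.1.count N * wt p q (x.1 ++ N :: x.2)
      = br p q m * gen p q N v m k := by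
  rw [marked, Finset.sum_biUnion, gen, Finset.mul_sum]
  · apply Finset.sum_congr rfl
    intro w hw
    rw [← count_content (m := m) hv, ← (mem_words.1 hw).1.count_eq, ← sum_splits, Finset.sum_mul]
    apply Finset.sum_congr rfl
    intro x hx
    rw [mem_splits.1 hx]
  · intro w _ w' _ hne
    rw [Function.onFun, Finset.disjoint_left]
    intro x hx hxw
    exact hne ((mem_splits.1 hx).symm.trans (mem_splits.1 hxw))

/-- Marked good words with one valley less. -/
def markedPred (N v m : ℕ) : ℕ → Finset (List ℕ × List ℕ)
  | 0 => ∅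
  | k + 1 => marked N v m k

lemma mem_markedPred {N v m k : ℕ} {x : List ℕ × List ℕ} :
    x ∈ markedPred N v m k ↔ ∃ k', k = k' + 1 ∧ Good N v m k' (x.1 ++ N :: x.2) := by
  cases k <;> simp [markedPred, mem_marked]

lemma words_succ {N v m k : ℕ} (hv : v + 1 < N) :
    words N (v + 1) (m + 1) k =
      ((marked N v (m + 2) k).image fun x => x.1 ++ ([v + 1] ++ x.2)) ∪
      (((marked N v (m + 1) k).image fun x => x.1 ++ ([v + 1, N] ++ x.2)) ∪
      ((markedPred N v m k).image fun x => x.1 ++ ([N, v + 1, N] ++ x.2))) := by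
  ext w
  simp only [Finset.mem_union, Finset.mem_image, mem_marked, mem_markedPred, mem_words, Prod.exists,
    List.cons_append, List.nil_append]
  constructor
  · intro h
    have hmem : v + 1 ∈ w := h.1.mem_iff.2 (by simp [content])
    obtain ⟨A, B, rfl⟩ := List.append_of_mem hmem
    by_cases hl : ∀ x ∈ A.getLast?, x ≠ N
    · by_cases hh : ∀ x ∈ B.head?, x ≠ N
      · exact Or.inl ⟨A, B, (good_peak hv hl hh).1 h, rfl⟩
      · cases B with
        | nil => simp at hh
        | cons b B =>
          obtain rfl : N = b := by simpa [eq_comm] using hh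
          have hc : (A ++ [v + 1] ++ N :: B).IsChain fun a c => ¬ (a = N ∧ c = N) := by
            simpa using h.2.1
          exact Or.inr (Or.inl ⟨A, B, (good_asc hv hl (ends_of_isChain hc).2).1 h, rfl⟩)
    · rcases List.eq_nil_or_concat A with rfl | ⟨A, a, rfl⟩
      · simp at hl
      obtain rfl : N = a := by simpa [eq_comm] using hl
      rw [List.concat_eq_append, List.append_assoc, List.singleton_append] at h
      have hc := (ends_of_isChain h.2.1).1
      by_cases hh : ∀ x ∈ B.head?, x ≠ N
      · exact (not_good_desc hv hh h).elim
      · cases B with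
        | nil => simp at hh
        | cons b B =>
          obtain rfl : N = b := by simpa [eq_comm] using hh
          have hc' : (A ++ [N, v + 1] ++ N :: B).IsChain fun a c => ¬ (a = N ∧ c = N) := by
            simpa using h.2.1
          exact Or.inr (Or.inr ⟨A, B, (good_valley hv hc (ends_of_isChain hc').2).1 h, by simp⟩)
  · rintro (⟨A, B, h, rfl⟩ | ⟨A, B, h, rfl⟩ | ⟨A, B, h, rfl⟩)
    · obtain ⟨hl, hh⟩ := ends_of_isChain h.2.1
      exact (good_peak hv hl hh).2 h
    · obtain ⟨hl, hh⟩ := ends_of_isChain h.2.1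
      exact (good_asc hv hl hh).2 h
    · obtain ⟨k', hk, h'⟩ := h
      obtain ⟨hl, hh⟩ := ends_of_isChain h'.2.1
      exact (good_valley hv hl hh).2 ⟨k', hk, h'⟩

lemma notMem_of_good {N v m k : ℕ} (hv : v + 1 < N) {A B : List ℕ}
    (h : Good N v m k (A ++ N :: B)) : v + 1 ∉ A ∧ v + 1 ∉ B := by
  obtain ⟨hA, hB⟩ := perm_bounds h.1
  refine ⟨fun h => ?_, fun h => ?_⟩
  · have := hA _ h
    omega
  · have := hB _ h
    omega

lemma gen_succ {N v m k : ℕ} (hv : v + 1 < N) :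
    gen p q N (v + 1) (m + 1) k = br p q (m + 2) * gen p q N v (m + 2) k
      + (br p q (m + 1) * gen p q N v (m + 1) k
      + ∑ x ∈ markedPred N v m k,
          p ^ x.2.count N * q ^ x.1.count N * wt p q (x.1 ++ N :: x.2)) := by
  rw [← sum_marked p q (by omega), ← sum_marked p q (by omega), gen, words_succ hv,
    Finset.sum_union, Finset.sum_union, Finset.sum_image, Finset.sum_image, Finset.sum_image]
  · congr 1
    · refine Finset.sum_congr rfl fun x hx => ?_
      exact wt_insert p q hv (mem_marked.1 hx) _ (by simp)
    congr 1
    · refine Finset.sum_congr rfl fun x hx => ?_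
      exact wt_insert p q hv (mem_marked.1 hx) _ (by simp)
    · refine Finset.sum_congr rfl fun x hx => ?_
      obtain ⟨k', -, h⟩ := mem_markedPred.1 hx
      exact wt_insert p q hv h _ (by simp)
  · rintro ⟨A, B⟩ hx ⟨A', B'⟩ - he
    obtain ⟨k', -, h⟩ := mem_markedPred.1 hx
    obtain ⟨h1, h2⟩ := notMem_of_good hv h
    have he : (A ++ [N]) ++ (v + 1) :: (N :: B) = (A' ++ [N]) ++ (v + 1) :: (N :: B') := by
      simpa using he
    rw [List.append_cons_inj_of_notMem (by simp [h1, hv.ne]) (by simp [h2, hv.ne])] at he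
    simpa using he
  · rintro ⟨A, B⟩ hx ⟨A', B'⟩ - he
    obtain ⟨h1, h2⟩ := notMem_of_good hv (mem_marked.1 hx)
    have he : A ++ (v + 1) :: (N :: B) = A' ++ (v + 1) :: (N :: B') := by
      simpa using he
    rw [List.append_cons_inj_of_notMem h1 (by simp [h2, hv.ne])] at he
    simpa using he
  · rintro ⟨A, B⟩ hx ⟨A', B'⟩ - he
    obtain ⟨h1, h2⟩ := notMem_of_good hv (mem_marked.1 hx)
    have he : A ++ (v + 1) :: B = A' ++ (v + 1) :: B' := by
      simpa using he
    rw [List.append_cons_inj_of_notMem h1 h2] at he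
    simpa using he
  · rw [Finset.disjoint_left]
    simp only [Finset.mem_image, Prod.exists, not_exists, not_and]
    rintro w ⟨A, B, hx, rfl⟩ A' B' - he
    obtain ⟨h1, h2⟩ := notMem_of_good hv (mem_marked.1 hx)
    have hl := (ends_of_isChain (mem_marked.1 hx).2.1).1
    have he : A ++ (v + 1) :: (N :: B) = (A' ++ [N]) ++ (v + 1) :: (N :: B') := by
      simpa using he.symm
    rw [List.append_cons_inj_of_notMem h1 (by simp [h2, hv.ne])] at he
    exact hl N (by rw [he.1]; simp) rfl
  · rw [Finset.disjoint_left]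
    simp only [Finset.mem_union, Finset.mem_image, Prod.exists]
    rintro w ⟨A, B, hx, rfl⟩ h
    obtain ⟨h1, h2⟩ := notMem_of_good hv (mem_marked.1 hx)
    have hh := (ends_of_isChain (mem_marked.1 hx).2.1).2
    obtain ⟨A', B', he⟩ : ∃ A' B', A ++ (v + 1) :: B = A' ++ (v + 1) :: (N :: B') := by
      rcases h with ⟨A', B', -, he⟩ | ⟨A', B', -, he⟩
      · exact ⟨A', B', by simpa using he.symm⟩
      · exact ⟨A' ++ [N], B', by simpa using he.symm⟩
    rw [List.append_cons_inj_of_notMem h1 h2] at he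
    exact hh N (by rw [he.2.2]; simp) rfl

lemma gen_zero_eq_zero {N m k : ℕ} (h : 0 < m ∨ 0 < k) :
    gen p q N 0 (m + 1) k = 0 := by
  rw [gen, Finset.sum_eq_zero]
  intro t ht
  obtain ⟨h1, h2, -, h4⟩ := mem_words.1 ht
  rw [content, List.perm_replicate] at h1
  subst h1
  cases m with
  | zero =>
    simp [pad, tri, IsVal] at h4
    omega
  | succ m => simp [List.replicate_succ] at h2

theorem dvd_gen {N v : ℕ} (hv : v < N) (m k : ℕ) :
    (p + q) ^ (k - m) * ∏ j ∈ Finset.range m, br p q (j + 1) ∣ gen p q N v (m + 1) k := by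
  induction v generalizing m k with
  | zero =>
    by_cases h : 0 < m ∨ 0 < k
    · rw [gen_zero_eq_zero p q h]
      exact dvd_zero _
    · obtain ⟨rfl, rfl⟩ : m = 0 ∧ k = 0 := by omega
      simp
  | succ v ih =>
    have ih := ih (by omega)
    rw [gen_succ p q hv]
    refine dvd_add ?_ (dvd_add ((ih m k).mul_left _) ?_)
    · have h1 : (p + q) ^ (k - m) ∣
          (p + q) ^ (k - (m + 1)) * (br p q (m + 1) * br p q (m + 2)) := by
        by_cases hk : m < k
        · rw [show k - m = k - (m + 1) + 1 by omega, pow_succ]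
          exact mul_dvd_mul_left _ (dvd_br_mul_br p q (m + 1))
        · rw [show k - m = 0 by omega, pow_zero]
          exact one_dvd _
      refine (mul_dvd_mul_right h1 _).trans ?_
      have h2 := mul_dvd_mul_left (br p q (m + 2)) (ih (m + 1) k)
      rw [Finset.prod_range_succ] at h2
      convert h2 using 1
      ring
    · cases k with
      | zero => simp [markedPred]
      | succ k =>
        rw [markedPred, sum_marked p q (by omega)]
        cases m with
        | zero => simp [br]
        | succ m =>
          have h2 := mul_dvd_mul_left (br p q (m + 1)) (ih m k)
          rw [Finset.prod_range_succ, Nat.add_sub_add_right]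
          convert h2 using 1
          ring

end Sums

section OneLine

lemma tri_map_range' (R : ℕ → ℕ → ℕ → Prop) (f : ℕ → ℕ) (s L : ℕ) :
    tri R ((List.range' s (L + 2)).map f)
      = ((Finset.Icc (s + 1) (s + L)).filter fun i => R (f (i - 1)) (f i) (f (i + 1))).card := by
  induction L generalizing s with
  | zero => simp [List.range'_succ, tri]
  | succ L ih =>
    have h : tri R ((List.range' s (L + 1 + 2)).map f)
        = (if R (f s) (f (s + 1)) (f (s + 2)) then 1 else 0)
          + tri R ((List.range' (s + 1) (L + 2)).map f) := by
      simp [List.range'_succ, tri]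
    rw [h, ih, show s + 1 + L = s + (L + 1) by ring,
      ← Finset.insert_Icc_add_one_left_eq_Icc (show s + 1 ≤ s + (L + 1) by omega),
      Finset.filter_insert]
    simp only [Nat.add_sub_cancel]
    split_ifs with hR
    · rw [Finset.card_insert_of_notMem (by simp)]
      omega
    · omega

lemma between_map_range' (b a : ℕ) (f : ℕ → ℕ) (s L : ℕ) :
    between b a ((List.range' s L).map f)
      = ((Finset.Ico s (s + L)).filter fun j => b < f j ∧ f j < a).card := by
  induction L generalizing s with
  | zero => simp
  | succ L ih =>
    rw [List.range'_succ, List.map_cons, between_cons, ih, show s + (L + 1) = s + 1 + L by ring,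
      ← Finset.insert_Ico_add_one_left_eq_Ico (show s < s + 1 + L by omega), Finset.filter_insert]
    split_ifs with hR
    · rw [Finset.card_insert_of_notMem (by simp)]
    · omega

lemma lesL_map_range' (f : ℕ → ℕ) (s L : ℕ) :
    lesL ((List.range' s (L + 1)).map f)
      = ∑ i ∈ Finset.Ico (s + 1) (s + 1 + L),
          ((Finset.Ico (i + 1) (s + 1 + L)).filter fun j => f i < f j ∧ f j < f (i - 1)).card := by
  induction L generalizing s with
  | zero => simp [lesL]
  | succ L ih =>
    have h : lesL ((List.range' s (L + 1 + 1)).map f)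
        = between (f (s + 1)) (f s) ((List.range' (s + 2) L).map f)
          + lesL ((List.range' (s + 1) (L + 1)).map f) := by
      simp [List.range'_succ, lesL]
    rw [h, ih, between_map_range', show s + 2 + L = s + 1 + (L + 1) by ring,
      Finset.sum_eq_sum_Ico_succ_bot (show s + 1 < s + 1 + (L + 1) by omega)]
    simp

lemma lesL_map_range'_one (f : ℕ → ℕ) (n : ℕ) :
    lesL ((List.range' 1 n).map f)
      = ((pairs n).filter fun x => 2 ≤ x.1 ∧ x.1 < x.2 ∧ f x.1 < f x.2 ∧ f x.2 < f (x.1 - 1)).card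
      := by
  cases n with
  | zero => simp [lesL, pairs]
  | succ L =>
    rw [lesL_map_range', ← Finset.card_sigma]
    refine Finset.card_bij' (fun x _ => (x.1, x.2)) (fun x _ => ⟨x.1, x.2⟩) ?_ ?_ ?_ ?_
    · rintro ⟨i, j⟩ h
      simp [pairs] at h ⊢
      omega
    · rintro ⟨i, j⟩ h
      simp [pairs] at h ⊢
      omega
    · simp
    · simp

lemma lesL_reverse_map_range'_one (f : ℕ → ℕ) (n : ℕ) :
    lesL ((List.range' 1 n).map f).reverse
      = ((pairs n).filter fun x => x.1 < x.2 ∧ x.2 ≤ n - 1 ∧ f x.2 < f x.1 ∧ f x.1 < f (x.2 + 1)).card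
      := by
  have h : ((List.range' 1 n).map f).reverse = (List.range' 1 n).map fun i => f (n + 1 - i) := by
    apply List.ext_getElem
    · simp
    · intro i h1 h2
      simp at h1 ⊢
      congr 1
      omega
  rw [h, lesL_map_range'_one]
  refine Finset.card_bij' (fun x _ => (n + 1 - x.2, n + 1 - x.1))
    (fun x _ => (n + 1 - x.2, n + 1 - x.1)) ?_ ?_ ?_ ?_
  · rintro ⟨i, j⟩ h
    simp only [pairs, Finset.mem_filter, Finset.mem_product, Finset.mem_Icc] at h ⊢
    rw [show n + 1 - (i - 1) = n + 1 - i + 1 by omega] at h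
    omega
  · rintro ⟨i, j⟩ h
    simp only [pairs, Finset.mem_filter, Finset.mem_product, Finset.mem_Icc] at h ⊢
    rw [show n + 1 - (n + 1 - j - 1) = j + 1 by omega, show n + 1 - (n + 1 - j) = j by omega,
      show n + 1 - (n + 1 - i) = i by omega]
    omega
  · rintro ⟨i, j⟩ h
    simp only [pairs, Finset.mem_filter, Finset.mem_product, Finset.mem_Icc] at h
    ext <;> simp <;> omega
  · rintro ⟨i, j⟩ h
    simp only [pairs, Finset.mem_filter, Finset.mem_product, Finset.mem_Icc] at h
    ext <;> simp <;> omega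

/-- The one-line notation of a permutation. -/
def oneLine (n : ℕ) (σ : Equiv.Perm (Fin n)) : List ℕ := (List.range' 1 n).map (pext n σ)

variable {n : ℕ}

lemma pext_succ (σ : Equiv.Perm (Fin n)) (i : Fin n) : pext n σ (i + 1) = σ i + 1 := by
  simp [pext]

lemma oneLine_eq_ofFn (σ : Equiv.Perm (Fin n)) :
    oneLine n σ = List.ofFn fun i => (σ i : ℕ) + 1 := by
  apply List.ext_getElem
  · simp [oneLine]
  · intro i h1 h2
    simp only [oneLine, List.length_map, List.length_range'] at h1
    simp only [oneLine, List.getElem_map, List.getElem_range', List.getElem_ofFn]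
    rw [← pext_succ]
    congr 1
    simp
    omega

lemma pad_oneLine (σ : Equiv.Perm (Fin n)) :
    pad (oneLine n σ) = (List.range' 0 (n + 2)).map (pext n σ) := by
  have h0 : pext n σ 0 = 0 := by simp [pext]
  have h1 : pext n σ (1 + n) = 0 := by simp [pext]
  rw [pad, oneLine, List.range'_succ, List.range'_concat]
  simp [h0, h1]

lemma tri_isVal_oneLine (σ : Equiv.Perm (Fin n)) :
    tri IsVal (pad (oneLine n σ)) = valleyStar n σ := by
  rw [pad_oneLine, tri_map_range', valleyStar]
  simp only [zero_add, IsVal]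

lemma tri_isDD_oneLine (σ : Equiv.Perm (Fin n)) :
    tri IsDD (pad (oneLine n σ)) = ddStar n σ := by
  rw [pad_oneLine, tri_map_range', ddStar]
  simp only [zero_add, IsDD]

lemma oneLine_injective : Function.Injective (oneLine n) := by
  intro σ τ h
  rw [oneLine_eq_ofFn, oneLine_eq_ofFn, List.ofFn_inj] at h
  ext i
  simpa using congrFun h i

lemma nodup_oneLine (σ : Equiv.Perm (Fin n)) : (oneLine n σ).Nodup := by
  rw [oneLine_eq_ofFn, List.nodup_ofFn]
  intro i j h
  simpa [Fin.val_inj] using h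

lemma mem_oneLine {σ : Equiv.Perm (Fin n)} {x : ℕ} : x ∈ oneLine n σ ↔ 1 ≤ x ∧ x ≤ n := by
  rw [oneLine_eq_ofFn, List.mem_ofFn]
  constructor
  · rintro ⟨i, rfl⟩
    have := (σ i).isLt
    omega
  · rintro ⟨h1, h2⟩
    refine ⟨σ.symm ⟨x - 1, by omega⟩, ?_⟩
    simp
    omega

lemma mem_content {N v m x : ℕ} (hm : 0 < m) :
    x ∈ content N v m ↔ (1 ≤ x ∧ x ≤ v) ∨ x = N := by
  refine ⟨of_mem_content, ?_⟩
  induction v with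
  | zero =>
    rintro (h | rfl)
    · omega
    · simp [content, hm.ne']
  | succ v ih =>
    intro h
    rw [content, List.mem_cons]
    by_cases hx : x = v + 1
    · exact Or.inl hx
    · exact Or.inr (ih (by omega))

lemma nodup_content {N v : ℕ} (hv : v < N) : (content N v 1).Nodup := by
  induction v with
  | zero => simp [content]
  | succ v ih =>
    rw [content, List.nodup_cons]
    refine ⟨fun h => ?_, ih (by omega)⟩
    have := of_mem_content h
    omega

lemma oneLine_perm_content (hn : 1 ≤ n) (σ : Equiv.Perm (Fin n)) :
    (oneLine n σ).Perm (content n (n - 1) 1) := by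
  rw [List.perm_ext_iff_of_nodup (nodup_oneLine σ) (nodup_content (by omega))]
  intro x
  rw [mem_oneLine, mem_content one_pos]
  omega

lemma exists_oneLine_eq (hn : 1 ≤ n) {t : List ℕ} (h : t.Perm (content n (n - 1) 1)) :
    ∃ σ, oneLine n σ = t := by
  have h' := h.trans (oneLine_perm_content hn 1).symm
  have hlen : t.length = n := by simpa [oneLine] using h'.length_eq
  have hnd : t.Nodup := h'.nodup_iff.2 (nodup_oneLine 1)
  have hmem : ∀ i (hi : i < t.length), 1 ≤ t[i] ∧ t[i] ≤ n := fun i hi =>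
    mem_oneLine.1 (h'.mem_iff.1 (List.getElem_mem hi))
  let f : Fin n → Fin n := fun i => ⟨t[(i : ℕ)] - 1, by have := hmem i (by omega); omega⟩
  have hf : Function.Injective f := by
    intro i j hij
    have h1 := hmem i (by omega)
    have h2 := hmem j (by omega)
    have h3 : t[(i : ℕ)] - 1 = t[(j : ℕ)] - 1 := congrArg Fin.val hij
    exact Fin.ext ((hnd.getElem_inj_iff).1 (show t[(i : ℕ)] = t[(j : ℕ)] by omega))
  refine ⟨Equiv.ofBijective f (Finite.injective_iff_bijective.1 hf), ?_⟩
  rw [oneLine_eq_ofFn]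
  apply List.ext_getElem
  · simp [hlen]
  · intro i h1 h2
    have := hmem i h2
    simp [f]
    omega

lemma isChain_of_nodup {N : ℕ} {t : List ℕ} (h : t.Nodup) :
    t.IsChain fun a b => ¬ (a = N ∧ b = N) := by
  refine List.IsChain.imp ?_ (List.Pairwise.isChain h)
  rintro a b hab ⟨rfl, rfl⟩
  exact hab rfl

lemma good_oneLine (hn : 1 ≤ n) (k : ℕ) (σ : Equiv.Perm (Fin n)) :
    Good n (n - 1) 1 k (oneLine n σ) ↔ valleyStar n σ = k ∧ ddStar n σ = 0 := by
  rw [Good, tri_isVal_oneLine, tri_isDD_oneLine]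
  simp only [oneLine_perm_content hn σ, isChain_of_nodup (nodup_oneLine σ), true_and]
  exact and_comm

open MvPolynomial in
lemma aPoly_eq_gen (hn : 1 ≤ n) (k : ℕ) :
    aPoly n k = gen (X 0 : MvPolynomial (Fin 2) ℤ) (X 1) n (n - 1) 1 k := by
  rw [aPoly, gen]
  refine Finset.sum_bij (fun σ _ => oneLine n σ) ?_ ?_ ?_ ?_
  · intro σ hσ
    rw [mem_words, good_oneLine hn]
    simpa using hσ
  · intro σ _ τ _ h
    exact oneLine_injective h
  · intro t ht
    rw [mem_words] at ht
    obtain ⟨σ, rfl⟩ := exists_oneLine_eq hn ht.1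
    exact ⟨σ, by simpa using (good_oneLine hn k σ).1 ht, rfl⟩
  · intro σ _
    rw [wt, oneLine, lesL_map_range'_one, lesL_reverse_map_range'_one]
    rfl

end OneLine

open MvPolynomial in
theorem statement1 (n k : ℕ) (hn : 1 ≤ n) (hk : k ≤ (n - 1) / 2) :
    ((X 0 : MvPolynomial (Fin 2) ℤ) + X 1) ^ k ∣ aPoly n k := by
  rw [aPoly_eq_gen hn]
  simpa using dvd_gen (X 0 : MvPolynomial (Fin 2) ℤ) (X 1) (show n - 1 < n by omega) 0 k

end SZpaper
end
end

section
/- For every integer n ≥ 1, the following identity holds in ℤ[p,q,w]: Σ_{σ∈S_n} p^{less σ} q^{ress σ} w^{peak_B σ} = Σ_{k=0}^{⌊(n−1)/2⌋} a_{n,k}(p,q) · 2^{n−1−2k} · w^k. Equivalently, for each k, a_{n,k}(p,q) = 2^{−n+1+2k} · Σ_{σ∈S_n, peak_B σ = k} p^{less σ} q^{ress σ}. -/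
open scoped Classical
open Finset

noncomputable section

namespace SZpaper

open MvPolynomial in
/-- `a_{n,k}(p,q)` (with `p = X 0`, `q = X 1`), as an element of `ℤ[p,q,w]`. -/
def aPoly3 (n k : ℕ) : MvPolynomial (Fin 3) ℤ :=
  ∑ σ ∈ Finset.univ.filter
      (fun σ : Equiv.Perm (Fin n) => valleyStar n σ = k ∧ ddStar n σ = 0),
    X 0 ^ resStat n σ * X 1 ^ lesStat n σ

/-! Linear statistics on words (lists of positive integers), read with the letter `0` appended. -/

/-- the number of descents of the word `w 0` that cross the level `y`. -/
def descCross (y : ℕ) : List ℕ → ℕ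
  | [] => 0
  | a :: l => (if l.headD 0 < y ∧ y < a then 1 else 0) + descCross y l

/-- the number of ascents of the word `w 0` that cross the level `y`. -/
def ascCross (y : ℕ) : List ℕ → ℕ
  | [] => 0
  | a :: l => (if a < y ∧ y < l.headD 0 then 1 else 0) + ascCross y l

def lesWord : List ℕ → ℕ
  | [] => 0
  | a :: l => (l.map fun y => if l.headD 0 < y ∧ y < a then 1 else 0).sum + lesWord l

def resWord : List ℕ → ℕ
  | [] => 0
  | a :: l => ascCross a l + resWord l

/-- the number of valleys of the word `w 0` preceded by the letter `p`. -/
def valleyWord (p : ℕ) : List ℕ → ℕ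
  | [] => 0
  | a :: l => (if a < p ∧ a < l.headD 0 then 1 else 0) + valleyWord a l

/-- the number of double descents of the word `w 0` preceded by the letter `p`. -/
def ddWord (p : ℕ) : List ℕ → ℕ
  | [] => 0
  | a :: l => (if l.headD 0 < a ∧ a < p then 1 else 0) + ddWord a l

theorem ascCross_add_ite (y : ℕ) (hy : 0 < y) (l : List ℕ) (hl : y ∉ l) :
    ascCross y l + (if y < l.headD 0 then 1 else 0) = descCross y l := by
  induction l with
  | nil => simp [ascCross, descCross]
  | cons b l ih =>
    simp only [List.mem_cons, not_or] at hl
    have h := ih hl.2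
    have h' : y ≠ l.headD 0 := by
      cases l with
      | nil => simpa using hy.ne'
      | cons c l => simp at hl ⊢; exact hl.2.1
    simp only [ascCross, descCross, List.headD_cons]
    generalize l.headD 0 = c at *
    grind

theorem ascCross_cons (y m : ℕ) (l : List ℕ) (hm : m < y) (hl : y ∉ l) :
    ascCross y (m :: l) = descCross y l := by
  rw [← ascCross_add_ite y (by omega) l hl]
  simp [ascCross, hm, add_comm]

theorem ascCross_append (y m : ℕ) (u v : List ℕ) (hm : m < y) (hv : y ∉ v)
    (hu : ∀ a ∈ u, m < a) :
    ascCross y (u ++ m :: v) = ascCross y u + descCross y v := by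
  induction u with
  | nil => simp [ascCross, ← ascCross_cons y m v hm hv]
  | cons a u ih =>
    have h := ih fun b hb => hu b (List.mem_cons_of_mem a hb)
    rw [List.cons_append, ascCross, h, ascCross]
    cases u with
    | nil => simp; omega
    | cons c u => simp; omega

theorem descCross_append (y m : ℕ) (u v : List ℕ) (hm : m < y) (hu : ∀ a ∈ u, m < a) :
    descCross y (u ++ m :: v) = descCross y u + descCross y v := by
  induction u with
  | nil => simp [descCross]; omega
  | cons a u ih =>
    have h := ih fun b hb => hu b (List.mem_cons_of_mem a hb)
    rw [List.cons_append, descCross, h, descCross]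
    cases u with
    | nil => simp; split_ifs <;> omega
    | cons c u => simp; omega

theorem descCross_eq_one (y : ℕ) (hy : 0 < y) (w : List ℕ) (hw : ∀ a ∈ w, y < a) (hne : w ≠ []) :
    descCross y w = 1 := by
  induction w with
  | nil => simp at hne
  | cons a w ih =>
    cases w with
    | nil => simpa [descCross, hy] using hw
    | cons b w =>
      rw [descCross, ih (fun c hc => hw c (List.mem_cons_of_mem a hc)) (by simp)]
      have := hw b (by simp)
      simp; omega

theorem ascCross_eq_zero (y : ℕ) (w : List ℕ) (hw : ∀ a ∈ w, y < a) : ascCross y w = 0 := by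
  induction w with
  | nil => rfl
  | cons a w ih =>
    rw [ascCross, ih fun b hb => hw b (List.mem_cons_of_mem a hb)]
    have := hw a (by simp)
    simp; omega

theorem lesWord_append (m : ℕ) (u v : List ℕ) (hu : ∀ a ∈ u, m < a) (hv : ∀ a ∈ v, m < a) :
    lesWord (u ++ m :: v) =
      lesWord u + lesWord v + (v.map fun y => descCross y u).sum := by
  induction u with
  | nil =>
    have : (v.map fun y => if v.headD 0 < y ∧ y < m then 1 else 0).sum = 0 := by
      rw [List.sum_eq_zero]
      intro x hx
      obtain ⟨y, hy, rfl⟩ := List.mem_map.1 hx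
      have := hv y hy
      rw [if_neg (by omega)]
    simpa [lesWord, descCross] using this
  | cons a u ih =>
    have h := ih fun b hb => hu b (List.mem_cons_of_mem a hb)
    have key : (((u ++ m :: v).map fun y =>
          if (u ++ m :: v).headD 0 < y ∧ y < a then 1 else 0).sum : ℕ) =
        (u.map fun y => if u.headD 0 < y ∧ y < a then 1 else 0).sum +
        (v.map fun y => if u.headD 0 < y ∧ y < a then 1 else 0).sum := by
      cases u with
      | nil =>
        simp only [List.nil_append, List.headD_cons, List.map_cons, List.sum_cons, List.map_nil,
          List.sum_nil, List.headD_nil, lt_irrefl, false_and, if_false]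
        congr 2
        refine List.map_congr_left fun y hy => ?_
        have := hv y hy
        simp only [this, true_and, show 0 < y by omega]
      | cons c u =>
        have := hu c (by simp)
        simp [show ¬ c < m by omega]
    rw [List.cons_append, lesWord, h, key]
    simp only [lesWord, descCross, List.sum_map_add]
    ring

theorem resWord_append (m : ℕ) (u v : List ℕ) (hu : ∀ a ∈ u, m < a) (hv : ∀ a ∈ v, m < a)
    (huv : ∀ a ∈ u, a ∉ v) :
    resWord (u ++ m :: v) =
      resWord u + resWord v + (u.map fun y => descCross y v).sum := by
  induction u with
  | nil => simp [resWord, ascCross_eq_zero m v hv]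
  | cons a u ih =>
    have h := ih (fun b hb => hu b (List.mem_cons_of_mem a hb))
      (fun b hb => huv b (List.mem_cons_of_mem a hb))
    rw [List.cons_append, resWord, h, resWord, ascCross_append a m u v (hu a (by simp))
      (huv a (by simp)) fun b hb => hu b (List.mem_cons_of_mem a hb)]
    simp only [List.map_cons, List.sum_cons]
    ring

theorem valleyWord_append (p m : ℕ) (u v : List ℕ) (hne : u ≠ []) (hu : ∀ a ∈ u, m < a)
    (hv : ∀ a ∈ v, m < a) :
    valleyWord p (u ++ m :: v) =
      valleyWord p u + valleyWord m v + (if v = [] then 0 else 1) := by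
  induction u generalizing p with
  | nil => simp at hne
  | cons a u ih =>
    have ha := hu a (by simp)
    cases u with
    | nil =>
      cases v with
      | nil => simp [valleyWord]; omega
      | cons b v =>
        have := hv b (by simp)
        simp only [valleyWord, List.cons_append, List.nil_append, List.headD_cons, List.headD_nil,
          reduceCtorEq, if_false, this, ha, and_self, if_true, show ¬ a < m by omega,
          show ¬ a < 0 by omega, and_false]
        omega
    | cons c u =>
      have h := ih a (by simp) fun b hb => hu b (List.mem_cons_of_mem a hb)
      rw [List.cons_append, valleyWord, h, valleyWord.eq_2 p a]
      change (if a < p ∧ a < c then 1 else 0) + _ = (if a < p ∧ a < c then 1 else 0) + _ + _ + _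
      ring

theorem ddWord_append (p m : ℕ) (u v : List ℕ) (hm : 0 < m) (hne : u ≠ [])
    (hu : ∀ a ∈ u, m < a) (hv : ∀ a ∈ v, m < a) :
    ddWord p (u ++ m :: v) = ddWord p u + ddWord m v + (if v = [] then 1 else 0) := by
  induction u generalizing p with
  | nil => simp at hne
  | cons a u ih =>
    have ha := hu a (by simp)
    cases u with
    | nil =>
      cases v with
      | nil => simp [ddWord]; split_ifs <;> omega
      | cons b v =>
        have := hv b (by simp)
        simp only [ddWord, List.cons_append, List.nil_append, List.headD_cons, List.headD_nil,
          reduceCtorEq, if_false, ha, show ¬ b < m by omega, show 0 < a by omega, true_and,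
          false_and]
        omega
    | cons c u =>
      have h := ih a (by simp) fun b hb => hu b (List.mem_cons_of_mem a hb)
      rw [List.cons_append, ddWord, h, ddWord.eq_2 p a]
      change (if c < a ∧ a < p then 1 else 0) + _ = (if c < a ∧ a < p then 1 else 0) + _ + _ + _
      ring

/-! Increasing binary trees. -/

/-- Nonempty binary trees with labels in `ℕ`, sorted by the kind of their root: a leaf, only a
right child, only a left child, or both children. -/
inductive BinTree
  | leaf (m : ℕ)
  | right (m : ℕ) (C : BinTree)
  | left (m : ℕ) (C : BinTree)
  | both (m : ℕ) (L R : BinTree)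

namespace BinTree

/-- the word obtained by reading the labels in symmetric order. -/
def word : BinTree → List ℕ
  | leaf m => [m]
  | right m C => m :: word C
  | left m C => word C ++ [m]
  | both m L R => word L ++ m :: word R

/-- labels increase along every path that leads away from the root. -/
def Increasing : BinTree → Prop
  | leaf _ => True
  | right m C => (∀ a ∈ word C, m < a) ∧ Increasing C
  | left m C => (∀ a ∈ word C, m < a) ∧ Increasing C
  | both m L R => ((∀ a ∈ word L, m < a) ∧ ∀ a ∈ word R, m < a) ∧ Increasing L ∧ Increasing R

/-- the number of maximal subtrees with all labels greater than `y`. -/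
def components (y : ℕ) : BinTree → ℕ
  | leaf m => if y < m then 1 else 0
  | right m C => if y < m then 1 else components y C
  | left m C => if y < m then 1 else components y C
  | both m L R => if y < m then 1 else components y L + components y R

def les : BinTree → ℕ
  | leaf _ => 0
  | right _ C => les C
  | left _ C => les C
  | both _ L R => les L + les R + ((word R).map fun y => components y L).sum

def res : BinTree → ℕ
  | leaf _ => 0
  | right _ C => res C
  | left _ C => res C
  | both _ L R => res L + res R + ((word L).map fun y => components y R).sum

/-- the number of vertices with two children. -/
def binary : BinTree → ℕ
  | leaf _ => 0
  | right _ C => binary C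
  | left _ C => binary C
  | both _ L R => binary L + binary R + 1

/-- the number of vertices with exactly one child. -/
def unary : BinTree → ℕ
  | leaf _ => 0
  | right _ C => unary C + 1
  | left _ C => unary C + 1
  | both _ L R => unary L + unary R

/-- the number of vertices with only a left child. -/
def lefts : BinTree → ℕ
  | leaf _ => 0
  | right _ C => lefts C
  | left _ C => lefts C + 1
  | both _ L R => lefts L + lefts R

/-- turn every only child into a right child. -/
def straighten : BinTree → BinTree
  | leaf m => leaf m
  | right m C => right m (straighten C)
  | left m C => right m (straighten C)
  | both m L R => both m (straighten L) (straighten R)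

/-- the set of trees which straighten to a given tree. -/
def flips : BinTree → Finset BinTree
  | leaf m => {leaf m}
  | right m C => (flips C).image (right m) ∪ (flips C).image (left m)
  | left _ _ => ∅
  | both m L R => (flips L ×ˢ flips R).image fun x => both m x.1 x.2

theorem word_ne_nil (T : BinTree) : word T ≠ [] := by
  cases T <;> simp [word]

theorem mem_flips (S T : BinTree) : S ∈ flips T ↔ straighten S = T := by
  induction T generalizing S with
  | leaf m => cases S <;> simp [flips, straighten]
  | right m C ih => cases S <;> simp [flips, straighten, ih, and_comm, eq_comm]
  | left m C ih => cases S <;> simp [flips, straighten]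
  | both m L R ihL ihR =>
    cases S <;> simp [flips, straighten, ihL, ihR, and_comm, and_assoc, eq_comm]

theorem card_flips (T : BinTree) (hT : lefts T = 0) : (flips T).card = 2 ^ unary T := by
  induction T with
  | leaf m => simp [flips, unary]
  | right m C ih =>
    rw [flips, card_union_of_disjoint, card_image_of_injective, card_image_of_injective, ih hT,
      unary]
    · ring
    · intro a b h; simpa using h
    · intro a b h; simpa using h
    · rw [disjoint_left]; simp
  | left m C ih => simp [lefts] at hT
  | both m L R ihL ihR =>
    simp only [lefts, Nat.add_eq_zero_iff] at hT
    rw [flips, card_image_of_injective, card_product, ihL hT.1, ihR hT.2, unary, pow_add]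
    rintro ⟨a, b⟩ ⟨c, d⟩ h
    simpa using h

theorem length_word (T : BinTree) : (word T).length = unary T + 2 * binary T + 1 := by
  induction T <;> simp_all [word, unary, binary] <;> omega

theorem lefts_straighten (T : BinTree) : lefts (straighten T) = 0 := by
  induction T <;> simp_all [straighten, lefts]

theorem binary_straighten (T : BinTree) : binary (straighten T) = binary T := by
  induction T <;> simp_all [straighten, binary]

theorem components_straighten (y : ℕ) (T : BinTree) :
    components y (straighten T) = components y T := by
  induction T <;> simp_all [straighten, components]

theorem word_straighten_perm (T : BinTree) : (word (straighten T)).Perm (word T) := by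
  induction T with
  | leaf m => rfl
  | right m C ih => exact ih.cons m
  | left m C ih => exact (ih.cons m).trans (List.perm_append_singleton m (word C)).symm
  | both m L R ihL ihR => exact ihL.append (ihR.cons m)

theorem les_straighten (T : BinTree) : les (straighten T) = les T := by
  induction T with
  | leaf m => rfl
  | right m C ih => exact ih
  | left m C ih => exact ih
  | both m L R ihL ihR =>
    simp only [straighten, les, ihL, ihR, components_straighten,
      ((word_straighten_perm R).map _).sum_eq]

theorem res_straighten (T : BinTree) : res (straighten T) = res T := by
  induction T with
  | leaf m => rfl
  | right m C ih => exact ih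
  | left m C ih => exact ih
  | both m L R ihL ihR =>
    simp only [straighten, res, ihL, ihR, components_straighten,
      ((word_straighten_perm L).map _).sum_eq]

theorem increasing_straighten (T : BinTree) : Increasing (straighten T) ↔ Increasing T := by
  induction T <;> simp_all [straighten, Increasing, (word_straighten_perm _).mem_iff]

/-! Statistics of a tree and of its word. -/

theorem descCross_word (y : ℕ) (T : BinTree) (hT : Increasing T) (hy : 0 < y)
    (h : y ∉ word T) : descCross y (word T) = components y T := by
  have aux : ∀ (m : ℕ) (u v : List ℕ), (∀ a ∈ u, m < a) → (∀ a ∈ v, m < a) → y ≠ m →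
      descCross y (u ++ m :: v) = if y < m then 1 else descCross y u + descCross y v := by
    intro m u v hu hv hm
    split_ifs with hlt
    · refine descCross_eq_one y hy _ (fun a ha => ?_) (by simp)
      simp only [List.mem_append, List.mem_cons] at ha
      rcases ha with ha | rfl | ha
      · exact hlt.trans (hu a ha)
      · exact hlt
      · exact hlt.trans (hv a ha)
    · exact descCross_append y m u v (by omega) hu
  induction T with
  | leaf m =>
    simp only [word, List.mem_singleton] at h
    simpa [word, components, descCross] using aux m [] [] (by simp) (by simp) h
  | right m C ih =>
    simp only [word, List.mem_cons, not_or] at h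
    have := aux m [] (word C) (by simp) hT.1 h.1
    simpa [word, components, ih hT.2 h.2, descCross] using this
  | left m C ih =>
    simp only [word, List.mem_append, List.mem_singleton, not_or] at h
    have := aux m (word C) [] hT.1 (by simp) h.2
    simpa [word, components, ih hT.2 h.1, descCross] using this
  | both m L R ihL ihR =>
    simp only [word, List.mem_append, List.mem_cons, not_or] at h
    have := aux m (word L) (word R) hT.1.1 hT.1.2 h.2.1
    simpa [word, components, ihL hT.2.1 h.1, ihR hT.2.2 h.2.2] using this

theorem lesWord_word (T : BinTree) (hT : Increasing T) (hd : (word T).Nodup) :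
    lesWord (word T) = les T := by
  induction T with
  | leaf m => simp [word, les, lesWord]
  | right m C ih =>
    have := lesWord_append m [] (word C) (by simp) hT.1
    simp only [word, List.nodup_cons] at hd
    simpa [word, les, ih hT.2 hd.2, lesWord, descCross] using this
  | left m C ih =>
    have := lesWord_append m (word C) [] hT.1 (by simp)
    simp only [word, List.nodup_append] at hd
    simpa [word, les, ih hT.2 hd.1, lesWord] using this
  | both m L R ihL ihR =>
    simp only [word, List.nodup_append, List.nodup_cons] at hd
    rw [word, les, lesWord_append m _ _ hT.1.1 hT.1.2, ihL hT.2.1 hd.1, ihR hT.2.2 hd.2.1.2]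
    congr 2
    refine List.map_congr_left fun y hy => descCross_word y L hT.2.1 ?_ fun h => ?_
    · have := hT.1.2 y hy; omega
    · exact hd.2.2 y h y (List.mem_cons_of_mem m hy) rfl

theorem resWord_word (T : BinTree) (hT : Increasing T) (hd : (word T).Nodup) :
    resWord (word T) = res T := by
  induction T with
  | leaf m => simp [word, res, resWord, ascCross]
  | right m C ih =>
    have := resWord_append m [] (word C) (by simp) hT.1 (by simp)
    simp only [word, List.nodup_cons] at hd
    simpa [word, res, ih hT.2 hd.2, resWord] using this
  | left m C ih =>
    have := resWord_append m (word C) [] hT.1 (by simp) (by simp)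
    simp only [word, List.nodup_append] at hd
    simpa [word, res, ih hT.2 hd.1, resWord, descCross] using this
  | both m L R ihL ihR =>
    simp only [word, List.nodup_append, List.nodup_cons] at hd
    have hLR : ∀ y ∈ word L, y ∉ word R := fun y h hy =>
      hd.2.2 y h y (List.mem_cons_of_mem m hy) rfl
    rw [word, res, resWord_append m _ _ hT.1.1 hT.1.2 hLR, ihL hT.2.1 hd.1,
      ihR hT.2.2 hd.2.1.2]
    congr 2
    refine List.map_congr_left fun y hy => descCross_word y R hT.2.2 ?_ (hLR y hy)
    have := hT.1.1 y hy; omega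

theorem valleyWord_word (p : ℕ) (T : BinTree) (hT : Increasing T) (hp : ∀ a ∈ word T, p < a) :
    valleyWord p (word T) = binary T := by
  induction T generalizing p with
  | leaf m => simp [word, binary, valleyWord]
  | right m C ih =>
    have := hp m (by simp [word])
    simp [word, binary, valleyWord, ih m hT.2 hT.1]; omega
  | left m C ih =>
    rw [word, valleyWord_append p m _ _ (word_ne_nil C) hT.1 (by simp),
      ih p hT.2 fun a ha => hp a (by simp [word, ha])]
    simp [binary, valleyWord]
  | both m L R ihL ihR =>
    rw [word, valleyWord_append p m _ _ (word_ne_nil L) hT.1.1 hT.1.2, if_neg (word_ne_nil R),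
      ihL p hT.2.1 fun a ha => hp a (by simp [word, ha]), ihR m hT.2.2 hT.1.2, binary]

theorem ddWord_word (p : ℕ) (T : BinTree) (hT : Increasing T) (hp : ∀ a ∈ word T, p < a) :
    ddWord p (word T) = lefts T := by
  induction T generalizing p with
  | leaf m =>
    have := hp m (by simp [word])
    simp [word, lefts, ddWord]; omega
  | right m C ih =>
    have := hp m (by simp [word])
    simp [word, lefts, ddWord, ih m hT.2 hT.1]; omega
  | left m C ih =>
    have := hp m (by simp [word])
    rw [word, ddWord_append p m _ _ (by omega) (word_ne_nil C) hT.1 (by simp),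
      ih p hT.2 fun a ha => hp a (by simp [word, ha])]
    simp [lefts, ddWord]
  | both m L R ihL ihR =>
    have := hp m (by simp [word])
    rw [word, ddWord_append p m _ _ (by omega) (word_ne_nil L) hT.1.1 hT.1.2,
      if_neg (word_ne_nil R), ihL p hT.2.1 fun a ha => hp a (by simp [word, ha]),
      ihR m hT.2.2 hT.1.2, lefts, add_zero]

/-! The increasing tree of a word. -/

/-- insert the label `a` as the first letter of the word of a tree. -/
def insertFirst (a : ℕ) : BinTree → BinTree
  | leaf m => if a < m then right a (leaf m) else left m (leaf a)
  | right m C => if a < m then right a (right m C) else both m (leaf a) C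
  | left m C => if a < m then right a (left m C) else left m (insertFirst a C)
  | both m L R => if a < m then right a (both m L R) else both m (insertFirst a L) R

/-- the increasing tree of a nonempty word. -/
def ofWord : List ℕ → BinTree
  | [] => leaf 0
  | [a] => leaf a
  | a :: b :: l => insertFirst a (ofWord (b :: l))

theorem ofWord_cons (a : ℕ) (l : List ℕ) (hl : l ≠ []) :
    ofWord (a :: l) = insertFirst a (ofWord l) := by
  cases l with
  | nil => simp at hl
  | cons b l => rfl

theorem word_insertFirst (a : ℕ) (T : BinTree) : word (insertFirst a T) = a :: word T := by
  induction T with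
  | leaf m => simp only [insertFirst]; split_ifs <;> simp [word]
  | right m C ih => simp only [insertFirst]; split_ifs <;> simp [word]
  | left m C ih => simp only [insertFirst]; split_ifs <;> simp [word, ih]
  | both m L R ihL ihR => simp only [insertFirst]; split_ifs <;> simp [word, ihL]

theorem word_ofWord (l : List ℕ) (hl : l ≠ []) : word (ofWord l) = l := by
  induction l with
  | nil => simp at hl
  | cons a l ih =>
    cases l with
    | nil => rfl
    | cons b l => rw [ofWord_cons a _ (by simp), word_insertFirst, ih (by simp)]

theorem increasing_insertFirst (a : ℕ) (T : BinTree) (hT : Increasing T) (ha : a ∉ word T) :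
    Increasing (insertFirst a T) := by
  induction T with
  | leaf m =>
    simp only [word, List.mem_singleton] at ha
    simp only [insertFirst]; split_ifs <;> simp [Increasing, word] <;> omega
  | right m C ih =>
    simp only [word, List.mem_cons, not_or] at ha
    simp only [insertFirst]; split_ifs with h
    · refine ⟨?_, hT⟩
      simp only [word, List.mem_cons, forall_eq_or_imp]
      exact ⟨h, fun b hb => h.trans (hT.1 b hb)⟩
    · refine ⟨⟨?_, hT.1⟩, trivial, hT.2⟩
      simp [word]; omega
  | left m C ih =>
    simp only [word, List.mem_append, List.mem_singleton, not_or] at ha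
    simp only [insertFirst]; split_ifs with h
    · refine ⟨?_, hT⟩
      simp only [word, List.mem_append, List.mem_singleton]
      rintro b (hb | rfl)
      exacts [h.trans (hT.1 b hb), h]
    · refine ⟨?_, ih hT.2 ha.1⟩
      simp only [word_insertFirst, List.mem_cons, forall_eq_or_imp]
      exact ⟨by omega, hT.1⟩
  | both m L R ihL ihR =>
    simp only [word, List.mem_append, List.mem_cons, not_or] at ha
    simp only [insertFirst]; split_ifs with h
    · refine ⟨?_, hT⟩
      simp only [word, List.mem_append, List.mem_cons]
      rintro b (hb | rfl | hb)
      exacts [h.trans (hT.1.1 b hb), h, h.trans (hT.1.2 b hb)]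
    · refine ⟨⟨?_, hT.1.2⟩, ihL hT.2.1 ha.1, hT.2.2⟩
      simp only [word_insertFirst, List.mem_cons, forall_eq_or_imp]
      exact ⟨by omega, hT.1.1⟩

theorem increasing_ofWord (l : List ℕ) (hl : l.Nodup) : Increasing (ofWord l) := by
  induction l with
  | nil => trivial
  | cons a l ih =>
    cases l with
    | nil => trivial
    | cons b l =>
      rw [List.nodup_cons] at hl
      rw [ofWord_cons a _ (by simp)]
      refine increasing_insertFirst a _ (ih hl.2) ?_
      rw [word_ofWord _ (by simp)]
      exact hl.1

theorem ofWord_append_left (m : ℕ) (u : List ℕ) (hne : u ≠ []) (hu : ∀ a ∈ u, m < a) :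
    ofWord (u ++ [m]) = left m (ofWord u) := by
  induction u with
  | nil => simp at hne
  | cons a u ih =>
    have ha := hu a (by simp)
    rw [List.cons_append, ofWord_cons a _ (by simp)]
    rcases eq_or_ne u [] with rfl | hu'
    · simp [ofWord, insertFirst, ha.le]
    · rw [ih hu' fun b hb => hu b (List.mem_cons_of_mem a hb), insertFirst, if_neg (by omega),
        ofWord_cons a u hu']

theorem ofWord_append_both (m : ℕ) (u : List ℕ) (T : BinTree) (hne : u ≠ [])
    (hu : ∀ a ∈ u, m < a) (hT : ofWord (m :: word T) = right m T) :
    ofWord (u ++ m :: word T) = both m (ofWord u) T := by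
  induction u with
  | nil => simp at hne
  | cons a u ih =>
    have ha := hu a (by simp)
    rw [List.cons_append, ofWord_cons a _ (by simp)]
    rcases eq_or_ne u [] with rfl | hu'
    · rw [List.nil_append, hT]
      simp [ofWord, insertFirst, ha.le]
    · rw [ih hu' fun b hb => hu b (List.mem_cons_of_mem a hb), insertFirst, if_neg (by omega),
        ofWord_cons a u hu']

theorem ofWord_word (T : BinTree) (hT : Increasing T) : ofWord (word T) = T := by
  have aux : ∀ (m : ℕ) (C : BinTree), (∀ a ∈ word C, m < a) → ofWord (word C) = C →
      ofWord (m :: word C) = right m C := by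
    intro m C hm hC
    rw [ofWord_cons m _ (word_ne_nil C), hC]
    cases C <;> simp_all [insertFirst, word]
  induction T with
  | leaf m => rfl
  | right m C ih => exact aux m C hT.1 (ih hT.2)
  | left m C ih => rw [word, ofWord_append_left m _ (word_ne_nil C) hT.1, ih hT.2]
  | both m L R ihL ihR =>
    rw [word, ofWord_append_both m _ R (word_ne_nil L) hT.1.1 (aux m R hT.1.2 (ihR hT.2.2)),
      ihL hT.2.1]

end BinTree

/-! Statistics of a function on an interval, and of its word. -/

section FunctionWords

variable (f : ℕ → ℕ)

theorem headD_map_range' (s n : ℕ) (h : f (s + n) = 0) :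
    ((List.range' s n).map f).headD 0 = f s := by
  cases n with
  | zero => simpa using h.symm
  | succ n => simp [List.range'_succ]

theorem valleyWord_map_range' (s n : ℕ) (h : f (s + 1 + n) = 0) :
    valleyWord (f s) ((List.range' (s + 1) n).map f) =
      ((Finset.Ico (s + 1) (s + 1 + n)).filter fun i => f i < f (i - 1) ∧ f i < f (i + 1)).card := by
  induction n generalizing s with
  | zero => simp [valleyWord]
  | succ n ih =>
    have h' : f (s + 1 + 1 + n) = 0 := by rw [← h]; congr 1; ring
    rw [List.range'_succ, List.map_cons, valleyWord, ih (s + 1) h', headD_map_range' f _ _ h',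
      ← Finset.insert_Ico_add_one_left_eq_Ico (by omega : s + 1 < s + 1 + (n + 1)),
      Finset.filter_insert, show s + 1 + (n + 1) = s + 1 + 1 + n by ring]
    split_ifs with h1 h2 h2
    · rw [Finset.card_insert_of_notMem (by simp), add_comm]
    · exact absurd h1 h2
    · exact absurd h2 h1
    · rw [zero_add]

theorem ddWord_map_range' (s n : ℕ) (h : f (s + 1 + n) = 0) :
    ddWord (f s) ((List.range' (s + 1) n).map f) =
      ((Finset.Ico (s + 1) (s + 1 + n)).filter fun i => f (i + 1) < f i ∧ f i < f (i - 1)).card := by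
  induction n generalizing s with
  | zero => simp [ddWord]
  | succ n ih =>
    have h' : f (s + 1 + 1 + n) = 0 := by rw [← h]; congr 1; ring
    rw [List.range'_succ, List.map_cons, ddWord, ih (s + 1) h', headD_map_range' f _ _ h',
      ← Finset.insert_Ico_add_one_left_eq_Ico (by omega : s + 1 < s + 1 + (n + 1)),
      Finset.filter_insert, show s + 1 + (n + 1) = s + 1 + 1 + n by ring]
    split_ifs with h1 h2 h2
    · rw [Finset.card_insert_of_notMem (by simp), add_comm]
    · exact absurd h1 h2
    · exact absurd h2 h1
    · rw [zero_add]

theorem ascCross_map_range' (y s n : ℕ) (h : f (s + n) = 0) :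
    ascCross y ((List.range' s n).map f) =
      ((Finset.Ico s (s + n)).filter fun j => f j < y ∧ y < f (j + 1)).card := by
  induction n generalizing s with
  | zero => simp [ascCross]
  | succ n ih =>
    have h' : f (s + 1 + n) = 0 := by rw [← h]; congr 1; ring
    rw [List.range'_succ, List.map_cons, ascCross, ih (s + 1) h', headD_map_range' f _ _ h',
      ← Finset.insert_Ico_add_one_left_eq_Ico (by omega : s < s + (n + 1)),
      Finset.filter_insert, show s + (n + 1) = s + 1 + n by ring]
    split_ifs
    · rw [Finset.card_insert_of_notMem (by simp), add_comm]
    · rw [zero_add]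

theorem resWord_map_range' (s n : ℕ) (h : f (s + n) = 0) :
    resWord ((List.range' s n).map f) =
      ∑ i ∈ Finset.Ico s (s + n),
        ((Finset.Ico (i + 1) (s + n)).filter fun j => f j < f i ∧ f i < f (j + 1)).card := by
  induction n generalizing s with
  | zero => simp [resWord]
  | succ n ih =>
    have h' : f (s + 1 + n) = 0 := by rw [← h]; congr 1; ring
    rw [List.range'_succ, List.map_cons, resWord, ih (s + 1) h', ascCross_map_range' f _ _ _ h',
      ← Finset.insert_Ico_add_one_left_eq_Ico (by omega : s < s + (n + 1)),
      Finset.sum_insert (by simp), show s + (n + 1) = s + 1 + n by ring]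

theorem sum_map_range' (s n : ℕ) (g : ℕ → ℕ) :
    ((List.range' s n).map g).sum = ∑ i ∈ Finset.Ico s (s + n), g i := by
  induction n generalizing s with
  | zero => simp
  | succ n ih =>
    rw [List.range'_succ, List.map_cons, List.sum_cons, ih,
      ← Finset.insert_Ico_add_one_left_eq_Ico (by omega : s < s + (n + 1)),
      Finset.sum_insert (by simp), show s + (n + 1) = s + 1 + n by ring]

theorem lesWord_map_range' (s n : ℕ) (h : f (s + n) = 0) :
    lesWord ((List.range' s n).map f) =
      ∑ i ∈ Finset.Ico s (s + n),
        ((Finset.Ico (i + 1) (s + n)).filter fun j => f (i + 1) < f j ∧ f j < f i).card := by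
  induction n generalizing s with
  | zero => simp [lesWord]
  | succ n ih =>
    have h' : f (s + 1 + n) = 0 := by rw [← h]; congr 1; ring
    rw [List.range'_succ, List.map_cons, lesWord, ih (s + 1) h', headD_map_range' f _ _ h',
      ← Finset.insert_Ico_add_one_left_eq_Ico (by omega : s < s + (n + 1)),
      Finset.sum_insert (by simp), show s + (n + 1) = s + 1 + n by ring, List.map_map,
      sum_map_range', Finset.card_filter]
    rfl

end FunctionWords

/-! Permutations and their words. -/

theorem pext_pos_le (n : ℕ) (σ : Equiv.Perm (Fin n)) (i : ℕ) (hi : 1 ≤ i ∧ i ≤ n) :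
    1 ≤ pext n σ i ∧ pext n σ i ≤ n := by
  rw [pext, dif_pos hi]
  omega

theorem pext_fin_succ (n : ℕ) (σ : Equiv.Perm (Fin n)) (i : Fin n) :
    pext n σ (i + 1) = σ i + 1 := by
  simp [pext]

theorem pext_injOn (n : ℕ) (σ : Equiv.Perm (Fin n)) (i j : ℕ) (hi : 1 ≤ i ∧ i ≤ n)
    (hj : 1 ≤ j ∧ j ≤ n) (h : pext n σ i = pext n σ j) : i = j := by
  rw [pext, pext, dif_pos hi, dif_pos hj] at h
  have h' := σ.injective (Fin.ext (Nat.succ.inj h))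
  simp only [Fin.mk.injEq] at h'
  omega

theorem pext_zero (n : ℕ) (σ : Equiv.Perm (Fin n)) : pext n σ 0 = 0 := by simp [pext]

theorem pext_last (n : ℕ) (σ : Equiv.Perm (Fin n)) : pext n σ (1 + n) = 0 := by simp [pext]

/-- the word `σ(1) ⋯ σ(n)`. -/
def permWord (n : ℕ) (σ : Equiv.Perm (Fin n)) : List ℕ := (List.range' 1 n).map (pext n σ)

theorem permWord_injective (n : ℕ) : Function.Injective (permWord n) := by
  intro σ τ h
  ext i
  have := List.map_inj_left.1 h (i + 1) (by simp; omega)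
  simpa [pext_fin_succ] using this

theorem permWord_nodup (n : ℕ) (σ : Equiv.Perm (Fin n)) : (permWord n σ).Nodup := by
  refine List.Nodup.map_on (fun i hi j hj h => ?_) List.nodup_range'
  simp only [List.mem_range'_1] at hi hj
  exact pext_injOn n σ i j (by omega) (by omega) h

theorem permWord_perm (n : ℕ) (σ : Equiv.Perm (Fin n)) :
    (permWord n σ).Perm (List.range' 1 n) := by
  refine ((permWord_nodup n σ).subperm fun a ha => ?_).perm_of_length_le (by simp [permWord])
  obtain ⟨i, hi, rfl⟩ := List.mem_map.1 ha
  simp only [List.mem_range'_1] at hi ⊢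
  have := pext_pos_le n σ i (by omega)
  omega

theorem exists_permWord_eq (n : ℕ) (l : List ℕ) (hl : l.Perm (List.range' 1 n)) :
    ∃ σ, permWord n σ = l := by
  have hlen : l.length = n := by simpa using hl.length_eq
  have hd : l.Nodup := hl.nodup_iff.2 List.nodup_range'
  have hmem : ∀ (i : ℕ) (hi : i < l.length), 1 ≤ l[i] ∧ l[i] < 1 + n := fun i hi => by
    simpa using hl.subset (List.getElem_mem hi)
  let g : Fin n → Fin n := fun i => ⟨l[i.1]'(by omega) - 1, by have := hmem i.1 (by omega); omega⟩
  have hg : Function.Injective g := by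
    intro i j hij
    simp only [g, Fin.mk.injEq] at hij
    have hi := hmem i.1 (by omega)
    have hj := hmem j.1 (by omega)
    have : l[i.1]'(by omega) = l[j.1]'(by omega) := by omega
    exact Fin.ext ((hd.getElem_inj_iff).1 this)
  refine ⟨Equiv.ofBijective g (Finite.injective_iff_bijective.1 hg), ?_⟩
  refine List.ext_getElem (by simp [permWord, hlen]) fun i h1 h2 => ?_
  have hi := hmem i h2
  have := pext_fin_succ n (Equiv.ofBijective g (Finite.injective_iff_bijective.1 hg))
    ⟨i, by omega⟩
  simp only [permWord, List.getElem_map, List.getElem_range', one_mul, add_comm 1 i, this]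
  simp [g]
  omega

theorem valleyWord_permWord (n : ℕ) (σ : Equiv.Perm (Fin n)) :
    valleyWord 0 (permWord n σ) = valleyStar n σ := by
  have := valleyWord_map_range' (pext n σ) 0 n (by simpa using pext_last n σ)
  rw [pext_zero, zero_add] at this
  rw [permWord, this, valleyStar, add_comm 1 n, Finset.Ico_add_one_right_eq_Icc]

theorem ddWord_permWord (n : ℕ) (σ : Equiv.Perm (Fin n)) :
    ddWord 0 (permWord n σ) = ddStar n σ := by
  have := ddWord_map_range' (pext n σ) 0 n (by simpa using pext_last n σ)
  rw [pext_zero, zero_add] at this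
  rw [permWord, this, ddStar, add_comm 1 n, Finset.Ico_add_one_right_eq_Icc]

theorem resWord_permWord (n : ℕ) (σ : Equiv.Perm (Fin n)) :
    resWord (permWord n σ) = resStat n σ := by
  rw [permWord, resWord_map_range' _ _ _ (pext_last n σ), ← Finset.card_sigma, resStat]
  refine Finset.card_nbij' (fun x => (x.1, x.2)) (fun x => ⟨x.1, x.2⟩) ?_ ?_ ?_ ?_
  · rintro ⟨i, j⟩ h
    simp only [mem_coe, mem_sigma, mem_filter, mem_Ico, pairs, mem_product, mem_Icc] at h ⊢
    have hj : j ≠ n := by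
      rintro rfl
      have := pext_last j σ
      rw [add_comm] at this
      omega
    omega
  · rintro ⟨i, j⟩ h
    simp only [mem_coe, mem_sigma, mem_filter, mem_Ico, pairs, mem_product, mem_Icc] at h ⊢
    omega
  · intro x _; rfl
  · intro x _; rfl

theorem lesWord_permWord (n : ℕ) (σ : Equiv.Perm (Fin n)) :
    lesWord (permWord n σ) = lesStat n σ := by
  rw [permWord, lesWord_map_range' _ _ _ (pext_last n σ), ← Finset.card_sigma, lesStat]
  refine Finset.card_nbij' (fun x => (x.1 + 1, x.2)) (fun x => ⟨x.1 - 1, x.2⟩) ?_ ?_ ?_ ?_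
  · rintro ⟨i, j⟩ h
    simp only [mem_coe, mem_sigma, mem_filter, mem_Ico, pairs, mem_product, mem_Icc,
      Nat.add_sub_cancel] at h ⊢
    have hj : j ≠ i + 1 := by
      rintro rfl
      omega
    omega
  · rintro ⟨i, j⟩ h
    simp only [mem_coe, mem_sigma, mem_filter, mem_Ico, pairs, mem_product, mem_Icc] at h ⊢
    rw [Nat.sub_add_cancel (by omega)]
    omega
  · intro x _; rfl
  · rintro ⟨i, j⟩ h
    simp only [mem_coe, mem_filter, pairs] at h
    simp only [Prod.mk.injEq, and_true]
    omega

/-- the increasing binary tree of a permutation. -/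
def permTree (n : ℕ) (σ : Equiv.Perm (Fin n)) : BinTree := BinTree.ofWord (permWord n σ)

theorem permWord_ne_nil (n : ℕ) (hn : 1 ≤ n) (σ : Equiv.Perm (Fin n)) : permWord n σ ≠ [] := by
  simp [permWord]; omega

theorem word_permTree (n : ℕ) (hn : 1 ≤ n) (σ : Equiv.Perm (Fin n)) :
    (permTree n σ).word = permWord n σ :=
  BinTree.word_ofWord _ (permWord_ne_nil n hn σ)

theorem increasing_permTree (n : ℕ) (σ : Equiv.Perm (Fin n)) : (permTree n σ).Increasing :=
  BinTree.increasing_ofWord _ (permWord_nodup n σ)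

theorem permTree_injective (n : ℕ) (hn : 1 ≤ n) : Function.Injective (permTree n) := by
  intro σ τ h
  apply permWord_injective n
  rw [← word_permTree n hn, ← word_permTree n hn, h]

theorem exists_permTree_eq_iff (n : ℕ) (hn : 1 ≤ n) (T : BinTree) :
    (∃ σ, permTree n σ = T) ↔ T.Increasing ∧ T.word.Perm (List.range' 1 n) := by
  constructor
  · rintro ⟨σ, rfl⟩
    exact ⟨increasing_permTree n σ, word_permTree n hn σ ▸ permWord_perm n σ⟩
  · rintro ⟨hT, hw⟩
    obtain ⟨σ, hσ⟩ := exists_permWord_eq n _ hw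
    exact ⟨σ, by rw [permTree, hσ, BinTree.ofWord_word T hT]⟩

theorem pos_of_mem_permWord (n : ℕ) (σ : Equiv.Perm (Fin n)) : ∀ a ∈ permWord n σ, 0 < a := by
  intro a ha
  have := (permWord_perm n σ).subset ha
  rw [List.mem_range'_1] at this
  omega

theorem binary_permTree (n : ℕ) (hn : 1 ≤ n) (σ : Equiv.Perm (Fin n)) :
    (permTree n σ).binary = valleyStar n σ := by
  have hw := word_permTree n hn σ
  rw [← valleyWord_permWord, ← hw, BinTree.valleyWord_word 0 _ (increasing_permTree n σ)]
  exact hw ▸ pos_of_mem_permWord n σ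

theorem lefts_permTree (n : ℕ) (hn : 1 ≤ n) (σ : Equiv.Perm (Fin n)) :
    (permTree n σ).lefts = ddStar n σ := by
  have hw := word_permTree n hn σ
  rw [← ddWord_permWord, ← hw, BinTree.ddWord_word 0 _ (increasing_permTree n σ)]
  exact hw ▸ pos_of_mem_permWord n σ

theorem res_permTree (n : ℕ) (hn : 1 ≤ n) (σ : Equiv.Perm (Fin n)) :
    (permTree n σ).res = resStat n σ := by
  have hw := word_permTree n hn σ
  rw [← resWord_permWord, ← hw, BinTree.resWord_word _ (increasing_permTree n σ)]
  exact hw ▸ permWord_nodup n σ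

theorem les_permTree (n : ℕ) (hn : 1 ≤ n) (σ : Equiv.Perm (Fin n)) :
    (permTree n σ).les = lesStat n σ := by
  have hw := word_permTree n hn σ
  rw [← lesWord_permWord, ← hw, BinTree.lesWord_word _ (increasing_permTree n σ)]
  exact hw ▸ permWord_nodup n σ

theorem unary_permTree (n : ℕ) (hn : 1 ≤ n) (σ : Equiv.Perm (Fin n)) :
    (permTree n σ).unary + 2 * valleyStar n σ + 1 = n := by
  rw [← binary_permTree n hn, ← BinTree.length_word, word_permTree n hn]
  simp [permWord]

theorem sum_valleyStar_eq {R : Type*} [CommSemiring R] (p q : R) (n k : ℕ) (hn : 1 ≤ n) :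
    ∑ σ ∈ Finset.univ.filter (fun σ : Equiv.Perm (Fin n) => valleyStar n σ = k),
        p ^ resStat n σ * q ^ lesStat n σ =
      2 ^ (n - 1 - 2 * k) *
        ∑ σ ∈ Finset.univ.filter
            (fun σ : Equiv.Perm (Fin n) => valleyStar n σ = k ∧ ddStar n σ = 0),
          p ^ resStat n σ * q ^ lesStat n σ := by
  have hstr : ∀ σ, ∃ τ, permTree n τ = (permTree n σ).straighten := by
    intro σ
    have h := (exists_permTree_eq_iff n hn _).1 ⟨σ, rfl⟩
    exact (exists_permTree_eq_iff n hn _).2 ⟨(BinTree.increasing_straighten _).2 h.1,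
      (BinTree.word_straighten_perm _).trans h.2⟩
  choose r hr using hstr
  have hval : ∀ σ, valleyStar n (r σ) = valleyStar n σ := fun σ => by
    rw [← binary_permTree n hn, ← binary_permTree n hn, hr, BinTree.binary_straighten]
  have hdd : ∀ σ, ddStar n (r σ) = 0 := fun σ => by
    rw [← lefts_permTree n hn, hr, BinTree.lefts_straighten]
  have hres : ∀ σ, resStat n (r σ) = resStat n σ := fun σ => by
    rw [← res_permTree n hn, ← res_permTree n hn, hr, BinTree.res_straighten]
  have hles : ∀ σ, lesStat n (r σ) = lesStat n σ := fun σ => by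
    rw [← les_permTree n hn, ← les_permTree n hn, hr, BinTree.les_straighten]
  rw [← Finset.sum_fiberwise_of_maps_to (g := r)
    (t := Finset.univ.filter fun σ => valleyStar n σ = k ∧ ddStar n σ = 0), Finset.mul_sum]
  · refine Finset.sum_congr rfl fun τ hτ => ?_
    simp only [mem_filter, mem_univ, true_and] at hτ
    have hfiber : (((Finset.univ.filter fun σ => valleyStar n σ = k).filter
        fun σ => r σ = τ).image (permTree n)) = (permTree n τ).flips := by
      ext S
      simp only [mem_image, mem_filter, mem_univ, true_and, BinTree.mem_flips]
      constructor
      · rintro ⟨σ, ⟨-, rfl⟩, rfl⟩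
        exact (hr σ).symm
      · intro hS
        have h := (exists_permTree_eq_iff n hn _).1 ⟨τ, rfl⟩
        rw [← hS, BinTree.increasing_straighten] at h
        obtain ⟨σ, rfl⟩ := (exists_permTree_eq_iff n hn S).2
          ⟨h.1, (BinTree.word_straighten_perm S).symm.trans h.2⟩
        rw [← hr σ] at hS
        have hS := permTree_injective n hn hS
        exact ⟨σ, ⟨by rw [← hval, hS, hτ.1], hS⟩, rfl⟩
    have hcard : ((Finset.univ.filter fun σ => valleyStar n σ = k).filter
        fun σ => r σ = τ).card = 2 ^ (n - 1 - 2 * k) := by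
      rw [← Finset.card_image_of_injective _ (permTree_injective n hn), hfiber,
        BinTree.card_flips _ (by rw [lefts_permTree n hn, hτ.2])]
      have := unary_permTree n hn τ
      congr 1
      omega
    rw [Finset.sum_congr rfl (g := fun _ => p ^ resStat n τ * q ^ lesStat n τ), Finset.sum_const,
      hcard]
    · simp
    · intro σ hσ
      rw [← (mem_filter.1 hσ).2, hres, hles]
  · intro σ hσ
    simp only [mem_filter, mem_univ, true_and] at hσ ⊢
    exact ⟨(hval σ).trans hσ, hdd σ⟩

/-! The reverse-complement. -/

/-- the reverse-complement `i ↦ n + 1 - σ(n + 1 - i)`. -/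
def reverseComplement (n : ℕ) : Equiv.Perm (Fin n) ≃ Equiv.Perm (Fin n) :=
  (Equiv.mulLeft Fin.revPerm).trans (Equiv.mulRight Fin.revPerm)

theorem pext_reverseComplement (n : ℕ) (σ : Equiv.Perm (Fin n)) (i : ℕ) (hi : 1 ≤ i ∧ i ≤ n) :
    pext n (reverseComplement n σ) (n + 1 - i) + pext n σ i = n + 1 := by
  rw [pext, pext, dif_pos hi, dif_pos (by omega)]
  have : Fin.rev (⟨n + 1 - i - 1, by omega⟩ : Fin n) = ⟨i - 1, by omega⟩ := by
    ext; simp; omega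
  simp only [reverseComplement, Equiv.trans_apply, Equiv.coe_mulLeft, Equiv.coe_mulRight,
    Equiv.Perm.mul_apply, Fin.revPerm_apply, this, Fin.val_rev]
  omega

theorem resStat_reverseComplement (n : ℕ) (σ : Equiv.Perm (Fin n)) :
    resStat n (reverseComplement n σ) = lessStat n σ := by
  have key := pext_reverseComplement n σ
  refine Finset.card_nbij' (fun x => (n + 1 - x.2, n + 1 - x.1))
    (fun x => (n + 1 - x.2, n + 1 - x.1)) ?_ ?_ ?_ ?_
  · rintro ⟨i, j⟩ h
    simp only [mem_coe, mem_filter, pairs, mem_product, mem_Icc] at h ⊢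
    have h1 := key (n + 1 - i) (by omega)
    have h2 := key (n + 1 - j) (by omega)
    have h3 := key (n + 1 - j - 1) (by omega)
    rw [show n + 1 - (n + 1 - i) = i by omega] at h1
    rw [show n + 1 - (n + 1 - j) = j by omega] at h2
    rw [show n + 1 - (n + 1 - j - 1) = j + 1 by omega] at h3
    omega
  · rintro ⟨i, j⟩ h
    simp only [mem_coe, mem_filter, pairs, mem_product, mem_Icc] at h ⊢
    have h1 := key i (by omega)
    have h2 := key j (by omega)
    have h3 := key (i - 1) (by omega)
    rw [show n + 1 - (i - 1) = n + 1 - i + 1 by omega] at h3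
    omega
  all_goals
    rintro ⟨i, j⟩ h
    simp only [mem_coe, mem_filter, pairs, mem_product, mem_Icc] at h
    simp only [Prod.mk.injEq]
    omega

theorem lesStat_reverseComplement (n : ℕ) (σ : Equiv.Perm (Fin n)) :
    lesStat n (reverseComplement n σ) = ressStat n σ := by
  have key := pext_reverseComplement n σ
  refine Finset.card_nbij' (fun x => (n + 1 - x.2, n + 1 - x.1))
    (fun x => (n + 1 - x.2, n + 1 - x.1)) ?_ ?_ ?_ ?_
  · rintro ⟨i, j⟩ h
    simp only [mem_coe, mem_filter, pairs, mem_product, mem_Icc] at h ⊢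
    have h1 := key (n + 1 - i) (by omega)
    have h2 := key (n + 1 - j) (by omega)
    have h3 := key (n + 1 - i + 1) (by omega)
    rw [show n + 1 - (n + 1 - i) = i by omega] at h1
    rw [show n + 1 - (n + 1 - j) = j by omega] at h2
    rw [show n + 1 - (n + 1 - i + 1) = i - 1 by omega] at h3
    omega
  · rintro ⟨i, j⟩ h
    simp only [mem_coe, mem_filter, pairs, mem_product, mem_Icc] at h ⊢
    have h1 := key i (by omega)
    have h2 := key j (by omega)
    have h3 := key (j + 1) (by omega)
    rw [show n + 1 - (j + 1) = n + 1 - j - 1 by omega] at h3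
    omega
  all_goals
    rintro ⟨i, j⟩ h
    simp only [mem_coe, mem_filter, pairs, mem_product, mem_Icc] at h
    simp only [Prod.mk.injEq]
    omega

theorem pextB_add_pext_reverseComplement (n : ℕ) (σ : Equiv.Perm (Fin n)) (i : ℕ)
    (hi : i ≤ n + 1) :
    pext n (reverseComplement n σ) (n + 1 - i) + pextB n σ i = n + 1 := by
  by_cases h : 1 ≤ i ∧ i ≤ n
  · have hB : pextB n σ i = pext n σ i := by rw [pextB, pext, dif_pos h, dif_pos h]
    rw [hB, pext_reverseComplement n σ i h]
  · rw [pextB, dif_neg h, pext, dif_neg (by omega), zero_add]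

theorem valleyStar_reverseComplement (n : ℕ) (σ : Equiv.Perm (Fin n)) :
    valleyStar n (reverseComplement n σ) = peakB n σ := by
  have key := pextB_add_pext_reverseComplement n σ
  refine Finset.card_nbij' (fun i => n + 1 - i) (fun i => n + 1 - i) ?_ ?_ ?_ ?_
  · intro i h
    simp only [mem_coe, mem_filter, mem_Icc] at h ⊢
    have h1 := key (n + 1 - i) (by omega)
    have h2 := key (n + 1 - i - 1) (by omega)
    have h3 := key (n + 1 - i + 1) (by omega)
    rw [show n + 1 - (n + 1 - i) = i by omega] at h1
    rw [show n + 1 - (n + 1 - i - 1) = i + 1 by omega] at h2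
    rw [show n + 1 - (n + 1 - i + 1) = i - 1 by omega] at h3
    omega
  · intro i h
    simp only [mem_coe, mem_filter, mem_Icc] at h ⊢
    have h1 := key i (by omega)
    have h2 := key (i - 1) (by omega)
    have h3 := key (i + 1) (by omega)
    rw [show n + 1 - (i - 1) = n + 1 - i + 1 by omega] at h2
    rw [show n + 1 - (i + 1) = n + 1 - i - 1 by omega] at h3
    omega
  all_goals
    intro i h
    simp only [mem_coe, mem_filter, mem_Icc] at h
    dsimp only
    omega

theorem sum_peakB_eq {R : Type*} [CommSemiring R] (p q : R) (n k : ℕ) (hn : 1 ≤ n) :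
    ∑ σ ∈ Finset.univ.filter (fun σ : Equiv.Perm (Fin n) => peakB n σ = k),
        p ^ lessStat n σ * q ^ ressStat n σ =
      2 ^ (n - 1 - 2 * k) *
        ∑ σ ∈ Finset.univ.filter
            (fun σ : Equiv.Perm (Fin n) => valleyStar n σ = k ∧ ddStar n σ = 0),
          p ^ resStat n σ * q ^ lesStat n σ := by
  rw [← sum_valleyStar_eq p q n k hn]
  refine Finset.sum_equiv (reverseComplement n) (fun σ => ?_) fun σ _ => ?_
  · simp [valleyStar_reverseComplement]
  · rw [resStat_reverseComplement, lesStat_reverseComplement]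

theorem peakB_le (n : ℕ) (hn : 1 ≤ n) (σ : Equiv.Perm (Fin n)) : peakB n σ ≤ (n - 1) / 2 := by
  have := unary_permTree n hn (reverseComplement n σ)
  rw [valleyStar_reverseComplement] at this
  omega

open MvPolynomial in
theorem statement2 (n : ℕ) (hn : 1 ≤ n) :
    ((∑ σ : Equiv.Perm (Fin n),
        (X 0 : MvPolynomial (Fin 3) ℤ) ^ lessStat n σ * X 1 ^ ressStat n σ *
          X 2 ^ peakB n σ) =
      ∑ k ∈ Finset.range ((n - 1) / 2 + 1),
        aPoly3 n k * 2 ^ (n - 1 - 2 * k) * X 2 ^ k) ∧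
    ∀ k ≤ (n - 1) / 2,
      (2 : MvPolynomial (Fin 3) ℤ) ^ (n - 1 - 2 * k) * aPoly3 n k =
        ∑ σ ∈ Finset.univ.filter
            (fun σ : Equiv.Perm (Fin n) => peakB n σ = k),
          (X 0 : MvPolynomial (Fin 3) ℤ) ^ lessStat n σ * X 1 ^ ressStat n σ := by
  refine ⟨?_, fun k _ => (sum_peakB_eq (X 0) (X 1) n k hn).symm⟩
  rw [← Finset.sum_fiberwise_of_maps_to (g := peakB n) (t := Finset.range ((n - 1) / 2 + 1))
    fun σ _ => Finset.mem_range.2 (Nat.lt_succ_of_le (peakB_le n hn σ))]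
  refine Finset.sum_congr rfl fun k _ => ?_
  rw [aPoly3, mul_comm _ (2 ^ _), ← sum_peakB_eq (X 0) (X 1) n k hn, Finset.sum_mul]
  refine Finset.sum_congr rfl fun σ hσ => ?_
  rw [(mem_filter.1 hσ).2]

end SZpaper
end
end
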